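/- arXiv:2104.00816 — 5 statements merged into one kernel-verified Lean document; each statement's English description precedes it below -/
import Mathlib

section
/- Let n, d ≥ 1 and k ≥ 2 be integers. Let M₁, …, M_k be nonempty pairwise disjoint Borel subsets of ℝᵈ, and for each i set dᵢ = inf{‖x − y‖ : x ∈ Mᵢ, y ∈ M_j for some j ≠ i}. Let P_data be a Borel probability measure on ℝᵈ with P_data(⋃ᵢ Mᵢ) = 1, and set πᵢ = P_data(Mᵢ); assume 0 < πᵢ < 1 for every i. Let c > 0, let G : ℝⁿ → ℝᵈ be c-Lipschitz, let P_model be the pushforward under G of the standard Gaussian measure γ_n on ℝⁿ, and set pᵢ = P_model(Mᵢ). For each i let πᵢ* = min(πᵢ, 1 − πᵢ) and let aᵢ be the unique real number with Φ(aᵢ) = πᵢ*. Then d_TV(P_data, P_model) ≥ Σᵢ₌₁ᵏ |πᵢ − pᵢ| ≥ δ, where δ = maxᵢ (πᵢ* − Φ(aᵢ − dᵢ/c)). -/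
open MeasureTheory ProbabilityTheory

/-- The cumulative distribution function of the standard normal distribution. -/
noncomputable def Phi (x : ℝ) : ℝ :=
  ∫ t in Set.Iic x, (2 * Real.pi) ^ (-(1 : ℝ) / 2) * Real.exp (-t ^ 2 / 2)

/-- The standard Gaussian measure on `ℝⁿ` (with its Euclidean norm): the law of a vector
of `n` independent standard normal random variables. -/
noncomputable def stdGaussian (n : ℕ) : Measure (EuclideanSpace ℝ (Fin n)) :=
  (Measure.pi fun _ : Fin n => gaussianReal 0 1).map
    (EuclideanSpace.equiv (Fin n) ℝ).symm

/-- The total variation distance between two finite measures: the total mass of the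
total variation measure of the signed measure `P - Q`. -/
noncomputable def tvDist {Ω : Type*} [MeasurableSpace Ω]
    (P Q : Measure Ω) [IsFiniteMeasure P] [IsFiniteMeasure Q] : ℝ :=
  ((P.toSignedMeasure - Q.toSignedMeasure).totalVariation Set.univ).toReal

namespace GaussIso

open Filter Topology Set
open scoped ENNReal RealInnerProductSpace Convolution

/-- The density of the standard normal distribution. -/
noncomputable def gaussDensity (x : ℝ) : ℝ :=
  (2 * Real.pi) ^ (-(1 : ℝ) / 2) * Real.exp (-x ^ 2 / 2)

lemma gaussDensity_eq : gaussDensity = gaussianPDFReal 0 1 := by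
  funext x
  have h : (2 * Real.pi) ^ (-(1 : ℝ) / 2) = (√(2 * Real.pi))⁻¹ := by
    rw [Real.sqrt_eq_rpow, ← Real.rpow_neg (by positivity)]
    norm_num
  simp [gaussDensity, gaussianPDFReal, h]

lemma gaussDensity_pos (x : ℝ) : 0 < gaussDensity x := by
  unfold gaussDensity; positivity

lemma gaussDensity_neg (x : ℝ) : gaussDensity (-x) = gaussDensity x := by
  simp [gaussDensity]

lemma hasDerivAt_gaussDensity (x : ℝ) :
    HasDerivAt gaussDensity (-x * gaussDensity x) x := by
  unfold gaussDensity
  have h : HasDerivAt (fun y : ℝ => -y ^ 2 / 2) (-x) x := by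
    have := ((hasDerivAt_pow 2 x).neg).div_const 2
    refine this.congr_deriv ?_
    push_cast
    ring
  refine ((h.exp).const_mul ((2 * Real.pi) ^ (-(1 : ℝ) / 2))).congr_deriv ?_
  ring

lemma continuous_gaussDensity : Continuous gaussDensity :=
  continuous_iff_continuousAt.2 fun x => (hasDerivAt_gaussDensity x).continuousAt

lemma integrable_gaussDensity : Integrable gaussDensity := by
  rw [gaussDensity_eq]; exact integrable_gaussianPDFReal 0 1

lemma integral_gaussDensity : ∫ x, gaussDensity x = 1 := by
  rw [gaussDensity_eq]; exact integral_gaussianPDFReal_eq_one 0 one_ne_zero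

lemma gaussDensity_le_of_sq_le {x y : ℝ} (h : y ^ 2 ≤ x ^ 2) :
    gaussDensity x ≤ gaussDensity y := by
  unfold gaussDensity
  gcongr

lemma gaussDensity_le_one (x : ℝ) : gaussDensity x ≤ 1 := by
  unfold gaussDensity
  have h1 : (2 * Real.pi) ^ (-(1 : ℝ) / 2) ≤ 1 :=
    Real.rpow_le_one_of_one_le_of_nonpos (by nlinarith [Real.pi_gt_three]) (by norm_num)
  have h2 : Real.exp (-x ^ 2 / 2) ≤ 1 := Real.exp_le_one_iff.2 (by nlinarith [sq_nonneg x])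
  calc _ ≤ (1 : ℝ) * 1 := by gcongr
    _ = 1 := one_mul 1

lemma Phi_eq (x : ℝ) : Phi x = ∫ t in Iic x, gaussDensity t := rfl

lemma Phi_sub (x y : ℝ) : Phi y - Phi x = ∫ t in x..y, gaussDensity t :=
  (intervalIntegral.integral_Iic_sub_Iic integrable_gaussDensity.integrableOn
    integrable_gaussDensity.integrableOn)

lemma hasDerivAt_Phi (x : ℝ) : HasDerivAt Phi (gaussDensity x) x := by
  have h : Phi = fun y => Phi 0 + ∫ t in (0 : ℝ)..y, gaussDensity t := by
    funext y; rw [← Phi_sub]; ring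
  rw [h]
  exact (intervalIntegral.integral_hasDerivAt_right
    (continuous_gaussDensity.intervalIntegrable _ _)
    (continuous_gaussDensity.stronglyMeasurableAtFilter _ _)
    continuous_gaussDensity.continuousAt).const_add _

lemma continuous_Phi : Continuous Phi :=
  continuous_iff_continuousAt.2 fun x => (hasDerivAt_Phi x).continuousAt

lemma strictMono_Phi : StrictMono Phi :=
  strictMono_of_hasDerivAt_pos hasDerivAt_Phi gaussDensity_pos

lemma Phi_neg (x : ℝ) : Phi (-x) = 1 - Phi x := by
  have h1 : Phi (-x) = ∫ t in Ioi x, gaussDensity t := by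
    rw [Phi_eq, ← neg_neg x, ← integral_comp_neg_Iic, neg_neg]
    simp only [gaussDensity_neg]
  have h2 := intervalIntegral.integral_Iic_add_Ioi (b := x)
    integrable_gaussDensity.integrableOn integrable_gaussDensity.integrableOn
  rw [integral_gaussDensity] at h2
  rw [h1, Phi_eq]
  linarith

lemma tendsto_Phi_atTop : Tendsto Phi atTop (𝓝 1) := by
  rw [← integral_gaussDensity, ← setIntegral_univ]
  have hcov := aecover_Iic (μ := (volume : Measure ℝ)) tendsto_id
  have := hcov.integral_tendsto_of_countably_generated
    integrable_gaussDensity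
  rw [setIntegral_univ]
  exact this

lemma tendsto_Phi_atBot : Tendsto Phi atBot (𝓝 0) := by
  have h : Phi = fun x => 1 - Phi (-x) := by funext x; rw [Phi_neg]; ring
  rw [h]
  simpa using (tendsto_Phi_atTop.comp tendsto_neg_atBot_atTop).const_sub 1

lemma Phi_pos (x : ℝ) : 0 < Phi x :=
  lt_of_le_of_lt (le_of_tendsto tendsto_Phi_atBot (by
    filter_upwards [eventually_le_atBot (x - 1)] with y hy
    exact strictMono_Phi.monotone hy)) (strictMono_Phi (sub_one_lt x))

lemma Phi_lt_one (x : ℝ) : Phi x < 1 := by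
  have := Phi_pos (-x)
  rw [Phi_neg] at this
  linarith

lemma Phi_mem (x : ℝ) : Phi x ∈ Ioo (0 : ℝ) 1 := ⟨Phi_pos x, Phi_lt_one x⟩

lemma Phi_zero : Phi 0 = 1 / 2 := by
  have := Phi_neg 0
  rw [neg_zero] at this
  linarith

lemma exists_Phi_eq {p : ℝ} (hp : p ∈ Ioo (0 : ℝ) 1) : ∃ x, Phi x = p := by
  have h0 := (tendsto_Phi_atBot.eventually_lt_const hp.1).exists
  have h1 := (tendsto_Phi_atTop.eventually_const_lt hp.2).exists
  obtain ⟨x, hx⟩ := h0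
  obtain ⟨y, hy⟩ := h1
  exact mem_range_of_exists_le_of_exists_ge continuous_Phi ⟨x, hx.le⟩ ⟨y, hy.le⟩

/-- The standard normal quantile function, inverse to `Phi` on `(0, 1)`. -/
noncomputable def quantile : ℝ → ℝ := Function.invFun Phi

lemma quantile_Phi (x : ℝ) : quantile (Phi x) = x :=
  Function.leftInverse_invFun strictMono_Phi.injective x

lemma Phi_quantile {p : ℝ} (hp : p ∈ Ioo (0 : ℝ) 1) : Phi (quantile p) = p :=
  Function.invFun_eq (exists_Phi_eq hp)

lemma strictMonoOn_quantile : StrictMonoOn quantile (Ioo 0 1) := by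
  intro x hx y hy hxy
  rw [← strictMono_Phi.lt_iff_lt, Phi_quantile hx, Phi_quantile hy]
  exact hxy

lemma continuousAt_quantile {p : ℝ} (hp : p ∈ Ioo (0 : ℝ) 1) : ContinuousAt quantile p := by
  refine strictMonoOn_quantile.continuousAt_of_image_mem_nhds (Ioo_mem_nhds hp.1 hp.2) ?_
  have : quantile '' Ioo 0 1 = univ :=
    eq_univ_of_forall fun x => ⟨Phi x, Phi_mem x, quantile_Phi x⟩
  rw [this]
  exact univ_mem

lemma hasDerivAt_quantile {p : ℝ} (hp : p ∈ Ioo (0 : ℝ) 1) :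
    HasDerivAt quantile (gaussDensity (quantile p))⁻¹ p :=
  HasDerivAt.of_local_left_inverse (continuousAt_quantile hp) (hasDerivAt_Phi _)
    (gaussDensity_pos _).ne' (by
      filter_upwards [Ioo_mem_nhds hp.1 hp.2] with y hy using Phi_quantile hy)

lemma quantile_one_sub {p : ℝ} (hp : p ∈ Ioo (0 : ℝ) 1) : quantile (1 - p) = -quantile p := by
  conv_lhs => rw [← Phi_quantile hp, ← Phi_neg, quantile_Phi]

/-- The Gaussian isoperimetric profile. -/
noncomputable def isoProfile (p : ℝ) : ℝ := gaussDensity (quantile p)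

lemma isoProfile_pos (p : ℝ) : 0 < isoProfile p := gaussDensity_pos _

lemma isoProfile_Phi (x : ℝ) : isoProfile (Phi x) = gaussDensity x := by
  rw [isoProfile, quantile_Phi]

lemma isoProfile_one_sub {p : ℝ} (hp : p ∈ Ioo (0 : ℝ) 1) :
    isoProfile (1 - p) = isoProfile p := by
  rw [isoProfile, quantile_one_sub hp, gaussDensity_neg, isoProfile]

lemma hasDerivAt_isoProfile {p : ℝ} (hp : p ∈ Ioo (0 : ℝ) 1) :
    HasDerivAt isoProfile (-quantile p) p := by
  have h := (hasDerivAt_gaussDensity (quantile p)).comp p (hasDerivAt_quantile hp)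
  refine h.congr_deriv ?_
  rw [mul_assoc, mul_inv_cancel₀ (gaussDensity_pos (quantile p)).ne', mul_one]

lemma nonneg_of_hasDerivAt_nonneg {e e' : ℝ → ℝ} {x : ℝ} (hx : 0 ≤ x)
    (hd : ∀ t ∈ Icc 0 x, HasDerivAt e (e' t) t) (h0 : 0 ≤ e 0)
    (hn : ∀ t ∈ Icc 0 x, 0 ≤ e' t) : 0 ≤ e x := by
  refine h0.trans (monotoneOn_of_hasDerivWithinAt_nonneg (convex_Icc 0 x)
    (fun t ht => (hd t ht).continuousAt.continuousWithinAt)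
    (fun t ht => (hd t (interior_subset ht)).hasDerivWithinAt)
    (fun t ht => hn t (interior_subset ht)) (left_mem_Icc.2 hx) (right_mem_Icc.2 hx) hx)

lemma monotone_div_gaussDensity : Monotone fun x => x / gaussDensity x := by
  refine monotone_of_hasDerivAt_nonneg
    (f' := fun x => (1 * gaussDensity x - x * (-x * gaussDensity x)) / gaussDensity x ^ 2)
    (fun x => (hasDerivAt_id x).div (hasDerivAt_gaussDensity x) (gaussDensity_pos x).ne') ?_
  intro x
  have := gaussDensity_pos x
  have h : 1 * gaussDensity x - x * (-x * gaussDensity x) = (1 + x ^ 2) * gaussDensity x := by ring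
  simp only [Pi.zero_apply, h]
  positivity

lemma monotoneOn_quantile_div_isoProfile :
    MonotoneOn (fun p => quantile p / isoProfile p) (Ioo 0 1) := fun _ hp _ hr h =>
  monotone_div_gaussDensity (strictMonoOn_quantile.monotoneOn hp hr h)

lemma hasDerivAt_quantile' {p : ℝ} (hp : p ∈ Ioo (0 : ℝ) 1) :
    HasDerivAt quantile (isoProfile p)⁻¹ p := hasDerivAt_quantile hp

lemma hasDerivAt_isoProfile_sq {p : ℝ} (hp : p ∈ Ioo (0 : ℝ) 1) :
    HasDerivAt (fun p => isoProfile p ^ 2) (-2 * (isoProfile p * quantile p)) p := by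
  refine ((hasDerivAt_isoProfile hp).pow 2).congr_deriv ?_
  push_cast
  ring

lemma hasDerivAt_isoProfile_mul_quantile {p : ℝ} (hp : p ∈ Ioo (0 : ℝ) 1) :
    HasDerivAt (fun p => isoProfile p * quantile p) (1 - quantile p ^ 2) p := by
  refine ((hasDerivAt_isoProfile hp).mul (hasDerivAt_quantile' hp)).congr_deriv ?_
  rw [mul_inv_cancel₀ (isoProfile_pos p).ne']
  ring

lemma hasDerivAt_quantile_sq {p : ℝ} (hp : p ∈ Ioo (0 : ℝ) 1) :
    HasDerivAt (fun p => quantile p ^ 2) (2 * (quantile p / isoProfile p)) p := by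
  refine ((hasDerivAt_quantile' hp).pow 2).congr_deriv ?_
  push_cast
  field_simp

lemma two_mul_quantile_sq_le {c x : ℝ} (hx : 0 ≤ x) (h0 : 0 < c - x) (h1 : c + x < 1) :
    2 * quantile c ^ 2 ≤ quantile (c + x) ^ 2 + quantile (c - x) ^ 2 := by
  have hp : ∀ t ∈ Icc 0 x, c + t ∈ Ioo (0 : ℝ) 1 := fun t ht =>
    ⟨by linarith [ht.1], by linarith [ht.2]⟩
  have hm : ∀ t ∈ Icc 0 x, c - t ∈ Ioo (0 : ℝ) 1 := fun t ht =>
    ⟨by linarith [ht.2], by linarith [ht.1]⟩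
  have key := nonneg_of_hasDerivAt_nonneg
    (e := fun t => quantile (c + t) ^ 2 + quantile (c - t) ^ 2 - 2 * quantile c ^ 2) hx
    (fun t ht => ((((hasDerivAt_quantile_sq (hp t ht)).comp_const_add c t).add
      ((hasDerivAt_quantile_sq (hm t ht)).comp_const_sub c t)).sub_const _)) (by
        simp only [add_zero, sub_zero]; linarith) (fun t ht => by
        have := monotoneOn_quantile_div_isoProfile (hm t ht) (hp t ht) (by linarith [ht.1])
        simp only at this
        linarith)
  linarith

lemma isoProfile_sq_add_le {c x : ℝ} (hx : 0 ≤ x) (h0 : 0 < c - x) (h1 : c + x < 1) :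
    2 * isoProfile c ^ 2 + 2 * quantile c ^ 2 * x ^ 2 ≤
      isoProfile (c + x) ^ 2 + isoProfile (c - x) ^ 2 + 2 * x ^ 2 := by
  have hp : ∀ t ∈ Icc 0 x, c + t ∈ Ioo (0 : ℝ) 1 := fun t ht =>
    ⟨by linarith [ht.1], by linarith [ht.2]⟩
  have hm : ∀ t ∈ Icc 0 x, c - t ∈ Ioo (0 : ℝ) 1 := fun t ht =>
    ⟨by linarith [ht.2], by linarith [ht.1]⟩
  have hJ : ∀ t ∈ Icc 0 x, 0 ≤ -2 * (isoProfile (c + t) * quantile (c + t)) -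
      -2 * (isoProfile (c - t) * quantile (c - t)) + (4 - 4 * quantile c ^ 2) * t := by
    intro t ht
    have hsub : Icc 0 t ⊆ Icc 0 x := Icc_subset_Icc_right ht.2
    refine nonneg_of_hasDerivAt_nonneg (e := fun t => -2 * (isoProfile (c + t) * quantile (c + t)) -
      -2 * (isoProfile (c - t) * quantile (c - t)) + (4 - 4 * quantile c ^ 2) * t) ht.1
      (fun s hs => ((((hasDerivAt_isoProfile_mul_quantile (hp s (hsub hs))).comp_const_add
        c s).const_mul (-2)).sub (((hasDerivAt_isoProfile_mul_quantile
        (hm s (hsub hs))).comp_const_sub c s).const_mul (-2))).add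
          ((hasDerivAt_id s).const_mul _)) (by simp) (fun s hs => ?_)
    have := two_mul_quantile_sq_le hs.1 (hm s (hsub hs)).1 (hp s (hsub hs)).2
    linarith
  have key := nonneg_of_hasDerivAt_nonneg
    (e := fun t => isoProfile (c + t) ^ 2 + isoProfile (c - t) ^ 2 +
      (2 - 2 * quantile c ^ 2) * t ^ 2 - 2 * isoProfile c ^ 2) hx
    (fun t ht => ((((hasDerivAt_isoProfile_sq (hp t ht)).comp_const_add c t).add
      ((hasDerivAt_isoProfile_sq (hm t ht)).comp_const_sub c t)).add
        ((hasDerivAt_pow 2 t).const_mul _)).sub_const _) (by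
        simp only [add_zero, sub_zero]; linarith) (fun t ht => by
        have := hJ t ht
        push_cast
        rw [pow_one]
        linarith)
  linarith

lemma isoProfile_sq_sub_le {c x : ℝ} (hc : c ≤ 1 / 2) (hx : 0 ≤ x) (h0 : 0 < c - x) :
    isoProfile (c + x) ^ 2 - isoProfile (c - x) ^ 2 ≤ -4 * (isoProfile c * quantile c) * x := by
  have hp : ∀ t ∈ Icc 0 x, c + t ∈ Ioo (0 : ℝ) 1 := fun t ht =>
    ⟨by linarith [ht.1], by linarith [ht.2]⟩
  have hm : ∀ t ∈ Icc 0 x, c - t ∈ Ioo (0 : ℝ) 1 := fun t ht =>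
    ⟨by linarith [ht.2], by linarith [ht.1]⟩
  have hJ : ∀ t ∈ Icc 0 x, 0 ≤ 2 * (isoProfile (c + t) * quantile (c + t)) +
      2 * (isoProfile (c - t) * quantile (c - t)) - 4 * (isoProfile c * quantile c) := by
    intro t ht
    have hsub : Icc 0 t ⊆ Icc 0 x := Icc_subset_Icc_right ht.2
    refine nonneg_of_hasDerivAt_nonneg (e := fun t => 2 * (isoProfile (c + t) * quantile (c + t)) +
      2 * (isoProfile (c - t) * quantile (c - t)) - 4 * (isoProfile c * quantile c)) ht.1
      (fun s hs => ((((hasDerivAt_isoProfile_mul_quantile (hp s (hsub hs))).comp_const_add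
        c s).const_mul 2).add (((hasDerivAt_isoProfile_mul_quantile
        (hm s (hsub hs))).comp_const_sub c s).const_mul 2)).sub_const _) (by
          simp only [add_zero, sub_zero]; linarith) (fun s hs => ?_)
    have hms := hm s (hsub hs)
    have hps := hp s (hsub hs)
    have h1 : quantile (c - s) ≤ quantile (c + s) :=
      strictMonoOn_quantile.monotoneOn hms hps (by linarith [hs.1])
    have h2 : quantile (c + s) ≤ -quantile (c - s) := by
      rw [← quantile_one_sub hms]
      exact strictMonoOn_quantile.monotoneOn hps ⟨by linarith [hms.2], by linarith [hms.1]⟩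
        (by linarith)
    nlinarith
  have key := nonneg_of_hasDerivAt_nonneg
    (e := fun t => -4 * (isoProfile c * quantile c) * t -
      (isoProfile (c + t) ^ 2 - isoProfile (c - t) ^ 2)) hx
    (fun t ht => ((hasDerivAt_id t).const_mul _).sub
      (((hasDerivAt_isoProfile_sq (hp t ht)).comp_const_add c t).sub
      ((hasDerivAt_isoProfile_sq (hm t ht)).comp_const_sub c t))) (by simp) (fun t ht => by
        have := hJ t ht
        linarith)
  linarith

lemma isoProfile_le_of_le {p r : ℝ} (hp : p ∈ Ioo (0 : ℝ) 1) (hr : r ∈ Ioo (0 : ℝ) 1)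
    (h : p ≤ r) (h' : p + r ≤ 1) : isoProfile p ≤ isoProfile r := by
  refine gaussDensity_le_of_sq_le ?_
  rw [← neg_sq (quantile p)]
  refine sq_le_sq' ?_ ?_
  · simpa using strictMonoOn_quantile.monotoneOn hp hr h
  · rw [← quantile_one_sub hp]
    exact strictMonoOn_quantile.monotoneOn hr ⟨by linarith [hp.2], by linarith [hp.1]⟩
      (by linarith)

lemma two_point_aux {c x : ℝ} (hc : c ≤ 1 / 2) (hx : 0 ≤ x) (h0 : 0 < c - x) :
    2 * isoProfile c ≤ √(isoProfile (c + x) ^ 2 + x ^ 2) + √(isoProfile (c - x) ^ 2 + x ^ 2) := by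
  have hm : c - x ∈ Ioo (0 : ℝ) 1 := ⟨h0, by linarith⟩
  have hp : c + x ∈ Ioo (0 : ℝ) 1 := ⟨by linarith, by linarith⟩
  have e1 := isoProfile_sq_add_le hx h0 hp.2
  have e2 := isoProfile_sq_sub_le hc hx h0
  have e3 := isoProfile_le_of_le hm hp (by linarith) (by linarith)
  have hcpos := isoProfile_pos c
  have hmpos := isoProfile_pos (c - x)
  have e4 : 0 ≤ isoProfile (c + x) ^ 2 - isoProfile (c - x) ^ 2 := by nlinarith
  set A := isoProfile (c + x) ^ 2 with hA
  set B := isoProfile (c - x) ^ 2 with hB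
  set K := isoProfile c
  set s := quantile c
  have e5 : (A - B) ^ 2 ≤ 8 * K ^ 2 * (A + B + 2 * x ^ 2 - 2 * K ^ 2) := by
    calc (A - B) ^ 2 ≤ (-4 * (K * s) * x) ^ 2 := pow_le_pow_left₀ e4 e2 2
      _ = 8 * K ^ 2 * (2 * s ^ 2 * x ^ 2) := by ring
      _ ≤ _ := by gcongr; linarith
  have hA0 : 0 ≤ A + x ^ 2 := by positivity
  have hB0 : 0 ≤ B + x ^ 2 := by positivity
  refine (sq_le_sq₀ (by positivity) (by positivity)).1 ?_
  rw [add_sq, Real.sq_sqrt hA0, Real.sq_sqrt hB0, mul_assoc 2 (√_), ← Real.sqrt_mul hA0]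
  have : 2 * K ^ 2 - (A + B + 2 * x ^ 2) / 2 ≤ √((A + x ^ 2) * (B + x ^ 2)) := by
    refine Real.le_sqrt_of_sq_le ?_
    nlinarith
  nlinarith

/-- Bobkov's two-point inequality. -/
lemma isoProfile_two_point {p r : ℝ} (hp : p ∈ Ioo (0 : ℝ) 1) (hr : r ∈ Ioo (0 : ℝ) 1) :
    2 * isoProfile ((p + r) / 2) ≤
      √(isoProfile p ^ 2 + ((p - r) / 2) ^ 2) + √(isoProfile r ^ 2 + ((p - r) / 2) ^ 2) := by
  wlog hle : r ≤ p generalizing p r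
  · have := this hr hp (by linarith)
    rw [add_comm r p] at this
    rw [add_comm (√_), show ((p - r) / 2) ^ 2 = ((r - p) / 2) ^ 2 by ring]
    exact this
  wlog hc : (p + r) / 2 ≤ 1 / 2 generalizing p r
  · have := @this (1 - r) (1 - p) ⟨by linarith [hr.2], by linarith [hr.1]⟩
      ⟨by linarith [hp.2], by linarith [hp.1]⟩ (by linarith) (by linarith)
    rw [isoProfile_one_sub hr, isoProfile_one_sub hp,
      show (1 - r + (1 - p)) / 2 = 1 - (p + r) / 2 by ring,
      isoProfile_one_sub ⟨by linarith [hp.1, hr.1], by linarith [hp.2, hr.2]⟩,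
      show 1 - r - (1 - p) = p - r by ring] at this
    linarith
  have := two_point_aux (x := (p - r) / 2) hc (by linarith) (by linarith [hr.1])
  rwa [show (p + r) / 2 + (p - r) / 2 = p by ring,
    show (p + r) / 2 - (p - r) / 2 = r by ring] at this

lemma integral_mem_Ioo {α : Type*} [MeasurableSpace α] {μ : Measure α} [IsProbabilityMeasure μ]
    {f : α → ℝ} (hf : Integrable f μ) (h : ∀ x, f x ∈ Ioo (0 : ℝ) 1) :
    ∫ x, f x ∂μ ∈ Ioo (0 : ℝ) 1 := by
  constructor
  · rw [integral_pos_iff_support_of_nonneg (fun x => (h x).1.le) hf]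
    have : Function.support f = univ := eq_univ_of_forall fun x => (h x).1.ne'
    simp [this]
  · have : 0 < ∫ x, (1 - f x) ∂μ := by
      rw [integral_pos_iff_support_of_nonneg (fun x => (sub_pos.2 (h x).2).le)
        ((integrable_const _).sub hf)]
      have : Function.support (fun x => 1 - f x) = univ :=
        eq_univ_of_forall fun x => (sub_pos.2 (h x).2).ne'
      simp [this]
    rw [integral_sub (integrable_const _) hf] at this
    simpa using this

lemma continuousAt_isoProfile {p : ℝ} (hp : p ∈ Ioo (0 : ℝ) 1) : ContinuousAt isoProfile p :=
  (hasDerivAt_isoProfile hp).continuousAt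

lemma isoProfile_le_one (p : ℝ) : isoProfile p ≤ 1 := gaussDensity_le_one _

lemma sqrt_sq_integral_add_le {Ω : Type*} [MeasurableSpace Ω] {μ : Measure Ω} {f g : Ω → ℝ}
    (hf : Integrable f μ) (hg : Integrable g μ)
    (hfg : Integrable (fun x => √(f x ^ 2 + g x ^ 2)) μ) :
    √((∫ x, f x ∂μ) ^ 2 + (∫ x, g x ∂μ) ^ 2) ≤ ∫ x, √(f x ^ 2 + g x ^ 2) ∂μ := by
  set A := ∫ x, f x ∂μ
  set B := ∫ x, g x ∂μ
  set R := √(A ^ 2 + B ^ 2) with hR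
  rcases (Real.sqrt_nonneg (A ^ 2 + B ^ 2)).eq_or_lt with h | h
  · rw [hR, ← h]
    exact integral_nonneg fun x => Real.sqrt_nonneg _
  have h1 : R * R = ∫ x, (A * f x + B * g x) ∂μ := by
    rw [integral_add (hf.const_mul _) (hg.const_mul _), integral_const_mul, integral_const_mul,
      Real.mul_self_sqrt (by positivity)]
    ring
  have h2 : ∫ x, (A * f x + B * g x) ∂μ ≤ ∫ x, R * √(f x ^ 2 + g x ^ 2) ∂μ := by
    refine integral_mono ((hf.const_mul _).add (hg.const_mul _)) (hfg.const_mul _) fun x => ?_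
    rw [hR, ← Real.sqrt_mul (by positivity)]
    refine Real.le_sqrt_of_sq_le ?_
    nlinarith [sq_nonneg (A * g x - B * f x)]
  rw [integral_const_mul, ← h1] at h2
  exact le_of_mul_le_mul_left h2 h

section Walk

variable {E : Type*} [NormedAddCommGroup E] [MeasurableSpace E]

/-- The law of the random walk `∑ εᵢ vᵢ` with independent uniform signs `εᵢ`, where the `vᵢ` are
the entries of a list. -/
noncomputable def signWalk : List E → Measure E
  | [] => Measure.dirac 0
  | v :: l => (2⁻¹ : ℝ≥0∞) • (signWalk l).map (fun z => z + v) +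
      (2⁻¹ : ℝ≥0∞) • (signWalk l).map (fun z => z - v)

variable [BorelSpace E]

instance isProbabilityMeasure_signWalk (l : List E) : IsProbabilityMeasure (signWalk l) := by
  induction l with
  | nil => unfold signWalk; infer_instance
  | cons v l ih =>
    constructor
    rw [signWalk, Measure.add_apply, Measure.smul_apply, Measure.smul_apply,
      Measure.map_apply (by fun_prop) .univ, Measure.map_apply (by fun_prop) .univ]
    simp [ENNReal.inv_two_add_inv_two]

variable [SecondCountableTopology E]

lemma integrable_of_continuous_of_norm_le {F : Type*} [NormedAddCommGroup F]
    {μ : Measure E} [IsFiniteMeasure μ] {f : E → F}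
    (hf : Continuous f) {C : ℝ} (hC : ∀ x, ‖f x‖ ≤ C) : Integrable f μ :=
  .of_bound hf.aestronglyMeasurable C (.of_forall hC)

lemma integral_signWalk_cons {F : Type*} [NormedAddCommGroup F] [NormedSpace ℝ F]
    (v : E) (l : List E) {f : E → F} (hf : Continuous f) {C : ℝ} (hC : ∀ x, ‖f x‖ ≤ C) :
    ∫ z, f z ∂signWalk (v :: l) =
      (2⁻¹ : ℝ) • (∫ z, f (z + v) ∂signWalk l + ∫ z, f (z - v) ∂signWalk l) := by
  have hi : ∀ (μ : Measure E) [IsFiniteMeasure μ], Integrable f μ := fun μ _ =>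
    integrable_of_continuous_of_norm_le hf hC
  rw [signWalk, integral_add_measure ((hi _).smul_measure (by simp))
    ((hi _).smul_measure (by simp)), integral_smul_measure, integral_smul_measure,
    integral_map (by fun_prop) hf.aestronglyMeasurable,
    integral_map (by fun_prop) hf.aestronglyMeasurable]
  simp

/-- Bobkov's functional inequality on the discrete cube. -/
theorem isoProfile_integral_signWalk_le (l : List E) {f : E → ℝ} {g : E → E → ℝ} {C : ℝ}
    (hf : Continuous f) (hf01 : ∀ x, f x ∈ Ioo (0 : ℝ) 1)
    (hg : ∀ v, Continuous (g v)) (hgC : ∀ v ∈ l, ∀ x, |g v x| ≤ C)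
    (hfg : ∀ v ∈ l, ∀ x, |f (x + v + v) - f x| ≤ 2 * g v x ∧ |f (x - v - v) - f x| ≤ 2 * g v x)
    (x : E) :
    isoProfile (∫ z, f (z + x) ∂signWalk l) ≤
      ∫ z, √(isoProfile (f (z + x)) ^ 2 + (l.map fun v => g v (z + x) ^ 2).sum) ∂signWalk l := by
  have hfle : ∀ x, ‖f x‖ ≤ 1 := fun x => by
    rw [Real.norm_of_nonneg (hf01 x).1.le]; exact (hf01 x).2.le
  have hsum0 : ∀ (l : List E) x, 0 ≤ (l.map fun v => g v x ^ 2).sum := fun l x =>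
    List.sum_nonneg (by simp only [List.mem_map]; rintro _ ⟨v, -, rfl⟩; positivity)
  have hIc : Continuous fun x => isoProfile (f x) := continuous_iff_continuousAt.2 fun x =>
    (continuousAt_isoProfile (hf01 x)).comp hf.continuousAt
  have hGc : ∀ l : List E,
      Continuous fun x => √(isoProfile (f x) ^ 2 + (l.map fun v => g v x ^ 2).sum) := by
    intro l
    refine Real.continuous_sqrt.comp ((hIc.pow 2).add ?_)
    exact continuous_list_sum l fun v _ => (hg v).pow 2
  have hGb : ∀ l : List E, (∀ v ∈ l, ∀ x, |g v x| ≤ C) → ∀ x,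
      ‖√(isoProfile (f x) ^ 2 + (l.map fun v => g v x ^ 2).sum)‖ ≤ √(1 + l.length * C ^ 2) := by
    intro l hgC x
    rw [Real.norm_of_nonneg (Real.sqrt_nonneg _)]
    refine Real.sqrt_le_sqrt (add_le_add ?_ ?_)
    · exact pow_le_one₀ (isoProfile_pos _).le (isoProfile_le_one _)
    · rw [← nsmul_eq_mul]
      have := List.sum_le_card_nsmul (l.map fun v => g v x ^ 2) (C ^ 2) (by
        simp only [List.mem_map]
        rintro _ ⟨v, hv, rfl⟩
        exact sq_le_sq.2 ((hgC v hv x).trans (le_abs_self C)))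
      simpa using this
  induction l generalizing x with
  | nil =>
    simp only [signWalk, List.map_nil, List.sum_nil, add_zero, integral_dirac, zero_add]
    exact (Real.le_sqrt' (isoProfile_pos _)).2 le_rfl
  | cons v l ih =>
    have hgCl : ∀ w ∈ l, ∀ x, |g w x| ≤ C := fun w hw => hgC w (List.mem_cons_of_mem _ hw)
    have ih' := ih hgCl fun w hw => hfg w (List.mem_cons_of_mem _ hw)
    set G : List E → E → ℝ :=
      fun l x => √(isoProfile (f x) ^ 2 + (l.map fun v => g v x ^ 2).sum) with hG
    have hcomp : ∀ y : E, Continuous fun z : E => z + y := fun y => by fun_prop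
    have hfi : ∀ y : E, Integrable (fun z => f (z + y)) (signWalk l) := fun y =>
      integrable_of_continuous_of_norm_le (hf.comp (hcomp y)) fun z => hfle _
    have hgi : ∀ y : E, Integrable (fun z => g v (z + y)) (signWalk l) := fun y =>
      integrable_of_continuous_of_norm_le ((hg v).comp (hcomp y)) fun z =>
        hgC v List.mem_cons_self _
    have hGi : ∀ l', (∀ v ∈ l', ∀ x, |g v x| ≤ C) → ∀ y : E,
        Integrable (fun z => G l' (z + y)) (signWalk l) := fun l' hl' y =>
      integrable_of_continuous_of_norm_le ((hGc l').comp (hcomp y)) fun z => hGb l' hl' _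
    have hmem : ∀ y : E, ∫ z, f (z + y) ∂signWalk l ∈ Ioo (0 : ℝ) 1 :=
      fun y => integral_mem_Ioo (hfi y) fun z => hf01 _
    have hstep : ∀ y y' : E, (∀ z, |f (z + y') - f (z + y)| ≤ 2 * g v (z + y)) →
        √(isoProfile (∫ z, f (z + y) ∂signWalk l) ^ 2 +
          ((∫ z, f (z + y) ∂signWalk l - ∫ z, f (z + y') ∂signWalk l) / 2) ^ 2) ≤
        ∫ z, G (v :: l) (z + y) ∂signWalk l := by
      intro y y' hyy
      have hGG : ∀ z, √(G l z ^ 2 + g v z ^ 2) = G (v :: l) z := by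
        intro z
        simp only [hG, List.map_cons, List.sum_cons]
        rw [Real.sq_sqrt (add_nonneg (sq_nonneg _) (hsum0 l z))]
        congr 1
        ring
      have hM := sqrt_sq_integral_add_le (hGi l hgCl y) (hgi y) (by
        simp only [hGG]; exact hGi _ hgC y)
      simp only [hGG] at hM
      refine le_trans (Real.sqrt_le_sqrt (add_le_add ?_ ?_)) hM
      · exact pow_le_pow_left₀ (isoProfile_pos _).le (ih' y) 2
      · rw [← integral_sub (hfi y) (hfi y'), ← integral_div]
        refine sq_le_sq.2 (le_trans ?_ (le_abs_self _))
        rw [← Real.norm_eq_abs]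
        refine norm_integral_le_of_norm_le (hgi y) (.of_forall fun z => ?_)
        rw [Real.norm_eq_abs, abs_div, abs_sub_comm]
        have := hyy z
        rw [abs_two]
        linarith
    rw [integral_signWalk_cons v l (f := fun z => f (z + x)) (hf.comp (hcomp x)) fun z => hfle _,
      integral_signWalk_cons v l (f := fun z => G (v :: l) (z + x)) ((hGc (v :: l)).comp (hcomp x))
        fun z => hGb (v :: l) hgC _]
    have e1 : ∀ z, z + v + x = z + (x + v) := fun z => by abel
    have e2 : ∀ z, z - v + x = z + (x - v) := fun z => by abel
    simp only [e1, e2, smul_eq_mul]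
    have h2 := isoProfile_two_point (hmem (x + v)) (hmem (x - v))
    have h3 := hstep (x + v) (x - v) fun z => by
      have := (hfg v List.mem_cons_self (z + (x + v))).2
      rwa [show z + (x + v) - v - v = z + (x - v) by abel] at this
    have h4 := hstep (x - v) (x + v) fun z => by
      have := (hfg v List.mem_cons_self (z + (x - v))).1
      rwa [show z + (x - v) + v + v = z + (x + v) by abel] at this
    rw [show ((∫ z, f (z + (x - v)) ∂signWalk l - ∫ z, f (z + (x + v)) ∂signWalk l) / 2) ^ 2 =
      ((∫ z, f (z + (x + v)) ∂signWalk l - ∫ z, f (z + (x - v)) ∂signWalk l) / 2) ^ 2 by ring]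
      at h4
    rw [inv_mul_eq_div, inv_mul_eq_div]
    linarith

end Walk

lemma charFun_signWalk {E : Type*} [NormedAddCommGroup E] [InnerProductSpace ℝ E]
    [MeasurableSpace E] [BorelSpace E] [SecondCountableTopology E] (l : List E) (t : E) :
    charFun (signWalk l) t = (l.map fun v => (Real.cos ⟪v, t⟫ : ℂ)).prod := by
  induction l with
  | nil => simp [signWalk]
  | cons v l ih =>
    have hc : Continuous fun x : E => Complex.exp (⟪x, t⟫ * Complex.I) := by fun_prop
    have h := integral_signWalk_cons v l hc (C := 1) fun x => by
      rw [Complex.norm_exp_ofReal_mul_I]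
    rw [charFun_apply, h, List.map_cons, List.prod_cons, ← ih, charFun_apply]
    have e1 : ∀ x, Complex.exp (⟪x + v, t⟫ * Complex.I) =
        Complex.exp (⟪x, t⟫ * Complex.I) * Complex.exp (⟪v, t⟫ * Complex.I) := fun x => by
      rw [inner_add_left, ← Complex.exp_add]; push_cast; ring_nf
    have e2 : ∀ x, Complex.exp (⟪x - v, t⟫ * Complex.I) =
        Complex.exp (⟪x, t⟫ * Complex.I) * Complex.exp (-⟪v, t⟫ * Complex.I) := fun x => by
      rw [inner_sub_left, ← Complex.exp_add]; push_cast; ring_nf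
    simp only [e1, e2]
    rw [integral_mul_const, integral_mul_const, Complex.ofReal_cos, Complex.cos]
    rw [Complex.real_smul]
    push_cast
    ring

section

lemma tendsto_cos_pow (t : ℝ) :
    Tendsto (fun N : ℕ => Real.cos ((√N)⁻¹ * t) ^ N) atTop (𝓝 (Real.exp (-t ^ 2 / 2))) := by
  have hs : Tendsto (fun N : ℕ => (√(N : ℝ))⁻¹ * t) atTop (𝓝 0) := by
    have := (tendsto_inv_atTop_zero.comp
      (Real.tendsto_sqrt_atTop.comp tendsto_natCast_atTop_atTop)).mul_const t
    simpa using this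
  have hlim : Tendsto (fun N : ℕ => t ^ 4 / N * (5 / 96)) atTop (𝓝 0) := by
    simpa using (tendsto_const_div_atTop_nhds_zero_nat (t ^ 4)).mul_const (5 / 96)
  have key : Tendsto (fun N : ℕ => (N : ℝ) * (Real.cos ((√N)⁻¹ * t) - 1)) atTop
      (𝓝 (-t ^ 2 / 2)) := by
    rw [tendsto_iff_dist_tendsto_zero]
    refine squeeze_zero' (.of_forall fun _ => dist_nonneg) ?_ hlim
    have h1 : ∀ᶠ N : ℕ in atTop, |(√(N : ℝ))⁻¹ * t| < 1 := by
      have := hs.abs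
      rw [abs_zero] at this
      exact this.eventually_lt_const one_pos
    filter_upwards [h1, eventually_gt_atTop 0] with N hN hN0
    have hN0' : (0 : ℝ) < N := by exact_mod_cast hN0
    have hb := Real.cos_bound hN.le
    have hsq : ((√(N : ℝ))⁻¹ * t) ^ 2 = t ^ 2 / N := by
      rw [mul_pow, inv_pow, Real.sq_sqrt hN0'.le]; ring
    have h4 : |(√(N : ℝ))⁻¹ * t| ^ 4 = t ^ 4 / N ^ 2 := by
      rw [show (4 : ℕ) = 2 * 2 from rfl, pow_mul, sq_abs, hsq]; ring
    rw [h4, hsq] at hb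
    rw [Real.dist_eq]
    calc |(N : ℝ) * (Real.cos ((√N)⁻¹ * t) - 1) - -t ^ 2 / 2|
        = |(N : ℝ) * (Real.cos ((√N)⁻¹ * t) - (1 - t ^ 2 / N / 2))| := by
          congr 1
          have : (N : ℝ) * (t ^ 2 / N / 2) = t ^ 2 / 2 := by field_simp
          linear_combination -this
      _ = (N : ℝ) * |Real.cos ((√N)⁻¹ * t) - (1 - t ^ 2 / N / 2)| := by
          rw [abs_mul, abs_of_pos hN0']
      _ ≤ (N : ℝ) * (t ^ 4 / N ^ 2 * (5 / 96)) := by gcongr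
      _ = t ^ 4 / N * (5 / 96) := by field_simp
  have := Real.tendsto_one_add_pow_exp_of_tendsto key
  simpa using this

variable {n : ℕ}

/-- The steps of the rescaled random walk on `ℝⁿ` making `N` steps in each coordinate. -/
noncomputable def walkSteps (n N : ℕ) : List (EuclideanSpace ℝ (Fin n)) :=
  (List.finRange n).flatMap fun j =>
    List.replicate N ((√(N : ℝ))⁻¹ • EuclideanSpace.single j (1 : ℝ))

lemma exists_of_mem_walkSteps {N : ℕ} {v : EuclideanSpace ℝ (Fin n)} (hv : v ∈ walkSteps n N) :
    ∃ j, v = (√(N : ℝ))⁻¹ • EuclideanSpace.single j (1 : ℝ) := by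
  simp only [walkSteps, List.mem_flatMap] at hv
  obtain ⟨j, -, hj⟩ := hv
  exact ⟨j, List.eq_of_mem_replicate hj⟩

lemma sum_map_walkSteps (N : ℕ) (F : EuclideanSpace ℝ (Fin n) → ℝ) :
    ((walkSteps n N).map F).sum =
      ∑ j, N * F ((√(N : ℝ))⁻¹ • EuclideanSpace.single j (1 : ℝ)) := by
  simp [walkSteps, List.flatMap, List.sum_flatten, Fin.sum_univ_def,
    Function.comp_def]

lemma prod_map_walkSteps (N : ℕ) (F : EuclideanSpace ℝ (Fin n) → ℂ) :
    ((walkSteps n N).map F).prod =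
      ∏ j, F ((√(N : ℝ))⁻¹ • EuclideanSpace.single j (1 : ℝ)) ^ N := by
  simp [walkSteps, List.flatMap, List.prod_flatten, Fin.prod_univ_def,
    Function.comp_def]

lemma tendsto_integral_signWalk {f : EuclideanSpace ℝ (Fin n) → ℝ} (hf : Continuous f) {C : ℝ}
    (hC : ∀ x, ‖f x‖ ≤ C) :
    Tendsto (fun N => ∫ x, f x ∂signWalk (walkSteps n N)) atTop
      (𝓝 (∫ x, f x ∂ProbabilityTheory.stdGaussian (EuclideanSpace ℝ (Fin n)))) := by
  have h := (ProbabilityMeasure.tendsto_iff_tendsto_charFun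
    (μ := fun N => ⟨signWalk (walkSteps n N), inferInstance⟩)
    (μ₀ := ⟨ProbabilityTheory.stdGaussian (EuclideanSpace ℝ (Fin n)), inferInstance⟩)).2 (by
      intro t
      simp only [ProbabilityMeasure.coe_mk, charFun_signWalk, prod_map_walkSteps,
        charFun_stdGaussian]
      have h1 : Tendsto (fun N : ℕ => ∏ j, Real.cos ((√N)⁻¹ * t j) ^ N) atTop
          (𝓝 (∏ j, Real.exp (-t j ^ 2 / 2))) :=
        tendsto_finsetProd _ fun j _ => tendsto_cos_pow (t j)
      rw [← Real.exp_sum, ← Finset.sum_div, Finset.sum_neg_distrib,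
        ← EuclideanSpace.real_norm_sq_eq] at h1
      have h2 := (Complex.continuous_ofReal.tendsto _).comp h1
      refine (h2.congr fun N => ?_).trans (by push_cast; rfl)
      simp [inner_smul_left, EuclideanSpace.inner_single_left])
  exact (ProbabilityMeasure.tendsto_iff_forall_integral_tendsto.1 h)
    (BoundedContinuousFunction.ofNormedAddCommGroup f hf C hC)

lemma abs_mul_gaussDensity_le_one (x : ℝ) : |(-x) * gaussDensity x| ≤ 1 := by
  have h1 : gaussDensity x ≤ Real.exp (-x ^ 2 / 2) := by
    have := gaussDensity_le_one 0
    simp only [gaussDensity] at this ⊢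
    norm_num at this ⊢
    exact mul_le_of_le_one_left (Real.exp_pos _).le (by simpa using this)
  have h2 : x ^ 2 / 2 + 1 ≤ Real.exp (x ^ 2 / 2) := Real.add_one_le_exp _
  have h3 : Real.exp (-x ^ 2 / 2) * Real.exp (x ^ 2 / 2) = 1 := by
    rw [← Real.exp_add]; ring_nf; exact Real.exp_zero
  rw [abs_mul, abs_neg, abs_of_pos (gaussDensity_pos x)]
  calc |x| * gaussDensity x ≤ Real.exp (x ^ 2 / 2) * Real.exp (-x ^ 2 / 2) := by
        have h4 : |x| ≤ Real.exp (x ^ 2 / 2) := by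
          nlinarith [sq_abs x, sq_nonneg (|x| - 1)]
        exact mul_le_mul h4 h1 (gaussDensity_pos x).le (Real.exp_pos _).le
    _ = 1 := by rw [mul_comm]; exact h3

lemma abs_gaussDensity_sub_le (x y : ℝ) : |gaussDensity y - gaussDensity x| ≤ |y - x| := by
  have := convex_univ.norm_image_sub_le_of_norm_hasDerivWithin_le (f := gaussDensity) (C := 1)
    (fun z _ => (hasDerivAt_gaussDensity z).hasDerivWithinAt)
    (fun z _ => abs_mul_gaussDensity_le_one z) (mem_univ x) (mem_univ y)
  simpa using this

lemma abs_Phi_sub_le (x y : ℝ) : |Phi y - Phi x| ≤ gaussDensity x * |y - x| + |y - x| ^ 2 := by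
  have := (convex_segment x y).norm_image_sub_le_of_norm_hasDerivWithin_le (f := Phi)
    (C := gaussDensity x + |y - x|)
    (fun z _ => (hasDerivAt_Phi z).hasDerivWithinAt)
    (fun z hz => by
      rw [Real.norm_of_nonneg (gaussDensity_pos z).le]
      have h1 := abs_gaussDensity_sub_le x z
      have h2 : |z - x| ≤ |y - x| := by
        rw [segment_eq_uIcc] at hz
        exact abs_sub_left_of_mem_uIcc hz
      linarith [le_abs_self (gaussDensity z - gaussDensity x)])
    (left_mem_segment ℝ x y) (right_mem_segment ℝ x y)
  rw [Real.norm_eq_abs, Real.norm_eq_abs] at this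
  linarith

/-- Bobkov's functional inequality for `Phi ∘ w` and the standard Gaussian measure, where `w` has
a Lipschitz derivative. -/
theorem isoProfile_integral_Phi_le_of_taylor {w : EuclideanSpace ℝ (Fin n) → ℝ}
    {w' : EuclideanSpace ℝ (Fin n) → EuclideanSpace ℝ (Fin n) →L[ℝ] ℝ} {b L : ℝ} (hb : 0 ≤ b)
    (hL : 0 ≤ L) (hw : ∀ x y, |w x - w y| ≤ b * ‖x - y‖) (hwc : Continuous w')
    (hw' : ∀ x, ‖w' x‖ ≤ b) (hT : ∀ x v, |w (x + v) - w x - w' x v| ≤ L * ‖v‖ ^ 2) :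
    isoProfile (∫ x, Phi (w x) ∂ProbabilityTheory.stdGaussian (EuclideanSpace ℝ (Fin n))) ≤
      √(1 + b ^ 2) *
        ∫ x, gaussDensity (w x) ∂ProbabilityTheory.stdGaussian (EuclideanSpace ℝ (Fin n)) := by
  have hwcont : Continuous w := by
    refine (LipschitzWith.of_dist_le_mul (K := ⟨b, hb⟩) fun x y => ?_).continuous
    rw [Real.dist_eq, dist_eq_norm]
    exact hw x y
  have hPc : Continuous fun x => Phi (w x) := continuous_Phi.comp hwcont
  have hDc : Continuous fun x => gaussDensity (w x) := continuous_gaussDensity.comp hwcont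
  have hPb : ∀ x, ‖Phi (w x)‖ ≤ 1 := fun x => by
    rw [Real.norm_of_nonneg (Phi_pos _).le]; exact (Phi_lt_one _).le
  have hDb : ∀ x, ‖gaussDensity (w x)‖ ≤ 1 := fun x => by
    rw [Real.norm_of_nonneg (gaussDensity_pos _).le]; exact gaussDensity_le_one _
  set K := 2 * L + 2 * b ^ 2 with hK
  have hK0 : 0 ≤ K := by positivity
  set g : EuclideanSpace ℝ (Fin n) → EuclideanSpace ℝ (Fin n) → ℝ := fun v x =>
    gaussDensity (w x) * |w' x v| + K * ‖v‖ ^ 2 with hg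
  have hgc : ∀ v, Continuous (g v) := fun v =>
    (hDc.mul (hwc.clm_apply continuous_const).abs).add continuous_const
  have hdiff : ∀ x v, |Phi (w (x + (v + v))) - Phi (w x)| ≤ 2 * g v x := by
    intro x v
    have h1 := abs_Phi_sub_le (w x) (w (x + (v + v)))
    have h2 := hT x (v + v)
    have h3 := hw (x + (v + v)) x
    rw [add_sub_cancel_left] at h3
    have h4 : ‖v + v‖ = 2 * ‖v‖ := by rw [← two_smul ℝ v, norm_smul]; simp
    rw [h4] at h2 h3
    have h5 : |w' x (v + v)| = 2 * |w' x v| := by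
      rw [map_add, ← two_mul, abs_mul, abs_two]
    have h6 : |w (x + (v + v)) - w x| ≤ 2 * |w' x v| + L * (2 * ‖v‖) ^ 2 := by
      rw [← h5]
      have := abs_add_le (w (x + (v + v)) - w x - w' x (v + v)) (w' x (v + v))
      rw [sub_add_cancel] at this
      linarith
    have h7 : |w (x + (v + v)) - w x| ^ 2 ≤ (b * (2 * ‖v‖)) ^ 2 :=
      pow_le_pow_left₀ (abs_nonneg _) h3 2
    have h8 := gaussDensity_pos (w x)
    have h9 := gaussDensity_le_one (w x)
    calc |Phi (w (x + (v + v))) - Phi (w x)|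
        ≤ gaussDensity (w x) * (2 * |w' x v| + L * (2 * ‖v‖) ^ 2) + (b * (2 * ‖v‖)) ^ 2 := by
          refine h1.trans (add_le_add ?_ h7)
          gcongr
      _ = 2 * (gaussDensity (w x) * |w' x v|) + gaussDensity (w x) * (L * (2 * ‖v‖) ^ 2) +
          (b * (2 * ‖v‖)) ^ 2 := by ring
      _ ≤ 2 * (gaussDensity (w x) * |w' x v|) + 1 * (L * (2 * ‖v‖) ^ 2) +
          (b * (2 * ‖v‖)) ^ 2 := by gcongr
      _ = 2 * g v x := by simp only [hg, hK]; ring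
  set η : ℕ → ℝ := fun N => n * (2 * b * K * (√(N : ℝ))⁻¹ + K ^ 2 * (√(N : ℝ))⁻¹ ^ 2) with hη
  have hη0 : Tendsto (fun N => √(η N)) atTop (𝓝 0) := by
    have hs : Tendsto (fun N : ℕ => (√(N : ℝ))⁻¹) atTop (𝓝 0) :=
      tendsto_inv_atTop_zero.comp (Real.tendsto_sqrt_atTop.comp tendsto_natCast_atTop_atTop)
    have h1 : Tendsto η atTop (𝓝 (n * (2 * b * K * 0 + K ^ 2 * 0 ^ 2))) :=
      ((hs.const_mul _).add ((hs.pow 2).const_mul _)).const_mul _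
    have h2 := (Real.continuous_sqrt.tendsto _).comp h1
    simpa [Function.comp_def] using h2
  have hmain : ∀ᶠ N : ℕ in atTop, isoProfile (∫ x, Phi (w x) ∂signWalk (walkSteps n N)) ≤
      √(1 + b ^ 2) * ∫ x, gaussDensity (w x) ∂signWalk (walkSteps n N) + √(η N) := by
    filter_upwards [eventually_gt_atTop 0] with N hN
    have hN0 : (0 : ℝ) < N := by exact_mod_cast hN
    set h := (√(N : ℝ))⁻¹ with hh
    have hh0 : 0 < h := by positivity
    have hNh : N * h ^ 2 = 1 := by
      rw [hh, inv_pow, Real.sq_sqrt hN0.le, mul_inv_cancel₀ hN0.ne']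
    have hnorm : ∀ j : Fin n,
        ‖h • (EuclideanSpace.single j (1 : ℝ) : EuclideanSpace ℝ (Fin n))‖ = h := fun j => by
      rw [norm_smul, PiLp.norm_single]; simp [abs_of_pos hh0]
    have hB := isoProfile_integral_signWalk_le (walkSteps n N) (f := fun x => Phi (w x)) (g := g)
      (C := b * h + K * h ^ 2) hPc (fun x => Phi_mem _) hgc (by
        intro v hv x
        obtain ⟨j, rfl⟩ := exists_of_mem_walkSteps hv
        rw [abs_of_nonneg (by have := gaussDensity_pos (w x); simp only [hg]; positivity)]
        simp only [hg]
        rw [← hh, hnorm]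
        refine add_le_add_left ?_ _
        calc gaussDensity (w x) * |w' x (h • EuclideanSpace.single j 1)|
            ≤ 1 * (b * ‖h • (EuclideanSpace.single j (1 : ℝ) : EuclideanSpace ℝ (Fin n))‖) := by
              gcongr
              · exact gaussDensity_le_one _
              · exact (w' x).le_of_opNorm_le (hw' x) _
          _ = b * h := by rw [hnorm, one_mul])
      (fun v _ x => ⟨by simpa [add_assoc] using hdiff x v, by
        have := hdiff x (-v)
        simp only [hg, map_neg, abs_neg, norm_neg] at this
        simpa [sub_eq_add_neg, add_assoc] using this⟩) 0
    simp only [add_zero] at hB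
    refine hB.trans ?_
    rw [← integral_const_mul]
    have hfin : Integrable (fun x => √(1 + b ^ 2) * gaussDensity (w x))
        (signWalk (walkSteps n N)) := (integrable_of_continuous_of_norm_le hDc hDb).const_mul _
    have hη' : √(η N) = ∫ _, √(η N) ∂signWalk (walkSteps n N) := by simp
    rw [hη', ← integral_add hfin (integrable_const _)]
    refine integral_mono_of_nonneg (.of_forall fun x => Real.sqrt_nonneg _)
      (hfin.add (integrable_const _)) (.of_forall fun x => ?_)
    simp only
    rw [isoProfile_Phi, sum_map_walkSteps, ← hh]
    set φ := gaussDensity (w x) with hφ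
    have hφ0 : 0 < φ := gaussDensity_pos _
    have hφ1 : φ ≤ 1 := gaussDensity_le_one _
    have hterm : ∀ j : Fin n, N * g (h • EuclideanSpace.single j 1) x ^ 2 ≤
        φ ^ 2 * (w' x (EuclideanSpace.single j 1)) ^ 2 + (2 * b * K * h + K ^ 2 * h ^ 2) := by
      intro j
      simp only [hg]
      rw [hnorm, map_smul, smul_eq_mul, abs_mul, abs_of_pos hh0, ← hφ]
      set p := w' x (EuclideanSpace.single j 1) with hp
      have hpb : |p| ≤ b := by
        have := (w' x).le_of_opNorm_le (hw' x) (EuclideanSpace.single j (1 : ℝ))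
        rwa [PiLp.norm_single, norm_one, mul_one, Real.norm_eq_abs] at this
      calc N * (φ * (h * |p|) + K * h ^ 2) ^ 2
          = (N * h ^ 2) * (φ ^ 2 * |p| ^ 2 + (2 * (φ * |p|) * K * h + K ^ 2 * h ^ 2)) := by ring
        _ ≤ (N * h ^ 2) * (φ ^ 2 * |p| ^ 2 + (2 * (1 * b) * K * h + K ^ 2 * h ^ 2)) := by
            gcongr
        _ = φ ^ 2 * p ^ 2 + (2 * b * K * h + K ^ 2 * h ^ 2) := by
            rw [hNh, sq_abs]; ring
    have hsum : ∑ j : Fin n, N * g (h • EuclideanSpace.single j 1) x ^ 2 ≤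
        φ ^ 2 * b ^ 2 + η N := by
      refine (Finset.sum_le_sum fun j _ => hterm j).trans ?_
      rw [Finset.sum_add_distrib, ← Finset.mul_sum]
      have hd := (EuclideanSpace.basisFun (Fin n) ℝ).norm_dual (w' x)
      simp only [EuclideanSpace.basisFun_apply] at hd
      rw [← hd]
      gcongr
      · exact hw' x
      · rw [Finset.sum_const, Finset.card_univ, Fintype.card_fin, nsmul_eq_mul]
    have hη00 : 0 ≤ η N := by simp only [hη]; positivity
    calc √(φ ^ 2 + ∑ j : Fin n, N * g (h • EuclideanSpace.single j 1) x ^ 2)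
        ≤ √((1 + b ^ 2) * φ ^ 2 + η N) := Real.sqrt_le_sqrt (by linarith)
      _ ≤ √((1 + b ^ 2) * φ ^ 2) + √(η N) := by
          rw [Real.sqrt_le_left (by positivity), add_sq, Real.sq_sqrt (by positivity),
            Real.sq_sqrt hη00]
          have : 0 ≤ √((1 + b ^ 2) * φ ^ 2) * √(η N) := by positivity
          linarith
      _ = √(1 + b ^ 2) * φ + √(η N) := by
          rw [Real.sqrt_mul (by positivity), Real.sqrt_sq hφ0.le]
  have hlim1 := tendsto_integral_signWalk hPc hPb
  have hmem : ∫ x, Phi (w x) ∂ProbabilityTheory.stdGaussian (EuclideanSpace ℝ (Fin n)) ∈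
      Ioo (0 : ℝ) 1 :=
    integral_mem_Ioo (integrable_of_continuous_of_norm_le hPc hPb) fun x => Phi_mem _
  have hlim2 := ((tendsto_integral_signWalk hDc hDb).const_mul (√(1 + b ^ 2))).add hη0
  rw [add_zero] at hlim2
  exact le_of_tendsto_of_tendsto ((continuousAt_isoProfile hmem).tendsto.comp hlim1) hlim2 hmain

end

section

variable {n : ℕ}

lemma abs_sub_sub_le_of_lipschitz_fderiv {E : Type*} [NormedAddCommGroup E] [NormedSpace ℝ E]
    {w : E → ℝ} {w' : E → E →L[ℝ] ℝ} {L : ℝ} (hL : 0 ≤ L) (hw : ∀ x, HasFDerivAt w (w' x) x)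
    (hw' : ∀ x y, ‖w' x - w' y‖ ≤ L * ‖x - y‖) (x v : E) :
    |w (x + v) - w x - w' x v| ≤ L * ‖v‖ ^ 2 := by
  have := (convex_segment x (x + v)).norm_image_sub_le_of_norm_hasFDerivWithin_le'
    (f := w) (f' := w') (φ := w' x) (C := L * ‖v‖)
    (fun z _ => (hw z).hasFDerivWithinAt) (fun z hz => by
      refine (hw' z x).trans ?_
      gcongr
      obtain ⟨t, ht, rfl⟩ := (segment_eq_image' ℝ x (x + v)) ▸ hz
      simp only [add_sub_cancel_left, norm_smul]
      rw [Real.norm_of_nonneg ht.1]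
      exact mul_le_of_le_one_left (norm_nonneg v) ht.2)
    (left_mem_segment ℝ _ _) (right_mem_segment ℝ _ _)
  rw [add_sub_cancel_left, Real.norm_eq_abs] at this
  linarith

lemma isoProfile_integral_Phi_le_of_bump {w : EuclideanSpace ℝ (Fin n) → ℝ} {b : ℝ} (hb : 0 ≤ b)
    (hw : ∀ x y, |w x - w y| ≤ b * ‖x - y‖) (φ : ContDiffBump (0 : EuclideanSpace ℝ (Fin n))) :
    ∃ u : EuclideanSpace ℝ (Fin n) → ℝ, Continuous u ∧ (∀ x, |u x - w x| ≤ b * φ.rOut) ∧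
      isoProfile (∫ x, Phi (u x) ∂ProbabilityTheory.stdGaussian (EuclideanSpace ℝ (Fin n))) ≤
      √(1 + b ^ 2) *
        ∫ x, gaussDensity (u x) ∂ProbabilityTheory.stdGaussian (EuclideanSpace ℝ (Fin n)) := by
  have hwcont : Continuous w := by
    refine (LipschitzWith.of_dist_le_mul (K := ⟨b, hb⟩) fun x y => ?_).continuous
    rw [Real.dist_eq, dist_eq_norm]
    exact hw x y
  set ρ := φ.normed volume with hρ
  have hρc : HasCompactSupport ρ := φ.hasCompactSupport_normed
  have hρs : ContDiff ℝ 1 ρ := φ.contDiff_normed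
  have hwi : LocallyIntegrable w := hwcont.locallyIntegrable
  set u := ρ ⋆[ContinuousLinearMap.lsmul ℝ ℝ, volume] w with hu
  set u' := fderiv ℝ ρ ⋆[(ContinuousLinearMap.lsmul ℝ ℝ).precompL (EuclideanSpace ℝ (Fin n)),
    volume] w with hu'
  have hder : ∀ x, HasFDerivAt u (u' x) x := fun x =>
    hρc.hasFDerivAt_convolution_left _ hρs hwi x
  have hρ'c : HasCompactSupport (fderiv ℝ ρ) := hρc.fderiv ℝ
  have hρ's : Continuous (fderiv ℝ ρ) := hρs.continuous_fderiv one_ne_zero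
  have hulip : ∀ x y, |u x - u y| ≤ b * ‖x - y‖ := by
    intro x y
    have hi : ∀ x, Integrable (fun t => ρ t • w (x - t)) := fun x =>
      Continuous.integrable_of_hasCompactSupport
        (hρs.continuous.smul (hwcont.comp (continuous_const.sub continuous_id))) hρc.smul_right
    have : u x - u y = ∫ t, ρ t • (w (x - t) - w (y - t)) := by
      simp only [hu, convolution_def, ContinuousLinearMap.lsmul_apply, smul_sub]
      rw [integral_sub (hi x) (hi y)]
    rw [this, ← Real.norm_eq_abs]
    calc ‖∫ t, ρ t • (w (x - t) - w (y - t))‖ ≤ ∫ t, ρ t * (b * ‖x - y‖) := by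
          refine norm_integral_le_of_norm_le (φ.integrable_normed.mul_const _)
            (.of_forall fun t => ?_)
          rw [norm_smul, Real.norm_of_nonneg (φ.nonneg_normed t)]
          have := hw (x - t) (y - t)
          rw [sub_sub_sub_cancel_right] at this
          exact mul_le_mul_of_nonneg_left this (φ.nonneg_normed t)
      _ = b * ‖x - y‖ := by rw [integral_mul_const, φ.integral_normed, one_mul]
  have hu'lip : ∀ x y, ‖u' x - u' y‖ ≤ ((∫ t, ‖fderiv ℝ ρ t‖) * b) * ‖x - y‖ := by
    intro x y
    have hi : ∀ x, Integrable (fun t => (ContinuousLinearMap.lsmul ℝ ℝ).precompL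
        (EuclideanSpace ℝ (Fin n)) (fderiv ℝ ρ t) (w (x - t))) := fun x =>
      (hρ'c.convolutionExists_left _ hρ's hwi x)
    have : u' x - u' y = ∫ t, (ContinuousLinearMap.lsmul ℝ ℝ).precompL
        (EuclideanSpace ℝ (Fin n)) (fderiv ℝ ρ t) (w (x - t) - w (y - t)) := by
      simp only [hu', convolution_def, map_sub]
      rw [integral_sub (hi x) (hi y)]
    rw [this, mul_assoc, ← integral_mul_const]
    refine norm_integral_le_of_norm_le
      ((hρ's.integrable_of_hasCompactSupport hρ'c).norm.mul_const _) (.of_forall fun t => ?_)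
    have h1 := hw (x - t) (y - t)
    rw [sub_sub_sub_cancel_right] at h1
    refine ContinuousLinearMap.opNorm_le_bound _ (by positivity) fun v => ?_
    rw [ContinuousLinearMap.precompL_apply]
    simp only [ContinuousLinearMap.lsmul_apply, smul_eq_mul, norm_mul]
    calc ‖fderiv ℝ ρ t v‖ * ‖w (x - t) - w (y - t)‖
        ≤ (‖fderiv ℝ ρ t‖ * ‖v‖) * (b * ‖x - y‖) := by
          gcongr
          · exact (fderiv ℝ ρ t).le_opNorm v
          · exact h1
      _ = _ := by ring
  have hL0 : 0 ≤ (∫ t, ‖fderiv ℝ ρ t‖) * b :=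
    mul_nonneg (integral_nonneg fun _ => norm_nonneg _) hb
  refine ⟨u, continuous_iff_continuousAt.2 fun x => (hder x).continuousAt, fun x => ?_,
    isoProfile_integral_Phi_le_of_taylor hb hL0 hulip ?_ ?_
      (abs_sub_sub_le_of_lipschitz_fderiv hL0 hder hu'lip)⟩
  · rw [← Real.dist_eq]
    refine φ.dist_normed_convolution_le hwcont.aestronglyMeasurable fun y hy => ?_
    rw [Real.dist_eq]
    refine (hw y x).trans ?_
    rw [← dist_eq_norm]
    gcongr
    exact (Metric.mem_ball.1 hy).le
  · refine (LipschitzWith.of_dist_le_mul (K := ⟨_, hL0⟩) fun x y => ?_).continuous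
    rw [dist_eq_norm, dist_eq_norm]
    exact hu'lip x y
  · intro x
    have hl : LipschitzWith ⟨b, hb⟩ u := LipschitzWith.of_dist_le_mul fun x y => by
      rw [Real.dist_eq, dist_eq_norm]
      exact hulip x y
    exact (hder x).le_of_lipschitz hl

/-- **Bobkov's functional inequality** for `Phi ∘ w` and the standard Gaussian measure, where `w`
is Lipschitz. -/
theorem isoProfile_integral_Phi_le {w : EuclideanSpace ℝ (Fin n) → ℝ} {b : ℝ} (hb : 0 ≤ b)
    (hw : ∀ x y, |w x - w y| ≤ b * ‖x - y‖) :
    isoProfile (∫ x, Phi (w x) ∂ProbabilityTheory.stdGaussian (EuclideanSpace ℝ (Fin n))) ≤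
      √(1 + b ^ 2) *
        ∫ x, gaussDensity (w x) ∂ProbabilityTheory.stdGaussian (EuclideanSpace ℝ (Fin n)) := by
  have hwcont : Continuous w := by
    refine (LipschitzWith.of_dist_le_mul (K := ⟨b, hb⟩) fun x y => ?_).continuous
    rw [Real.dist_eq, dist_eq_norm]
    exact hw x y
  let φ : ℕ → ContDiffBump (0 : EuclideanSpace ℝ (Fin n)) := fun k =>
    ⟨1 / ((k : ℝ) + 1) / 2, 1 / ((k : ℝ) + 1), by positivity, half_lt_self (by positivity)⟩
  choose u huc huw hu using fun k => isoProfile_integral_Phi_le_of_bump hb hw (φ k)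
  have hlim : ∀ x, Tendsto (fun k => u k x) atTop (𝓝 (w x)) := by
    intro x
    rw [tendsto_iff_dist_tendsto_zero]
    have h0 : Tendsto (fun k : ℕ => b * (1 / ((k : ℝ) + 1))) atTop (𝓝 0) := by
      simpa using tendsto_one_div_add_atTop_nhds_zero_nat.const_mul b
    exact squeeze_zero (fun _ => dist_nonneg) (fun k => huw k x) h0
  have h1 := tendsto_integral_of_dominated_convergence
    (μ := ProbabilityTheory.stdGaussian (EuclideanSpace ℝ (Fin n))) (F := fun k x => Phi (u k x))
    (f := fun x => Phi (w x)) (fun _ => 1)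
    (fun k => (continuous_Phi.comp (huc k)).aestronglyMeasurable) (integrable_const _)
    (fun k => .of_forall fun x => by
      rw [Real.norm_of_nonneg (Phi_pos _).le]; exact (Phi_lt_one _).le)
    (.of_forall fun x => (continuous_Phi.tendsto _).comp (hlim x))
  have h2 := tendsto_integral_of_dominated_convergence
    (μ := ProbabilityTheory.stdGaussian (EuclideanSpace ℝ (Fin n)))
    (F := fun k x => gaussDensity (u k x))
    (f := fun x => gaussDensity (w x)) (fun _ => 1)
    (fun k => (continuous_gaussDensity.comp (huc k)).aestronglyMeasurable) (integrable_const _)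
    (fun k => .of_forall fun x => by
      rw [Real.norm_of_nonneg (gaussDensity_pos _).le]; exact gaussDensity_le_one _)
    (.of_forall fun x => (continuous_gaussDensity.tendsto _).comp (hlim x))
  have hmem : ∫ x, Phi (w x) ∂ProbabilityTheory.stdGaussian (EuclideanSpace ℝ (Fin n)) ∈
      Ioo (0 : ℝ) 1 :=
    integral_mem_Ioo (integrable_of_continuous_of_norm_le (C := 1) (continuous_Phi.comp hwcont)
      fun x => by
        rw [Real.norm_of_nonneg (Phi_pos _).le]; exact (Phi_lt_one _).le)
      fun x => Phi_mem _
  exact le_of_tendsto_of_tendsto' ((continuousAt_isoProfile hmem).tendsto.comp h1)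
    (h2.const_mul _) hu

end

section

variable {n : ℕ}

/-- Growth of the Gaussian measure of a smoothed neighbourhood of `A`, in the quantile scale. -/
lemma quantile_integral_Phi_infDist_sub_le (A : Set (EuclideanSpace ℝ (Fin n))) {b : ℝ}
    (hb : 0 < b) {s t : ℝ} (hst : s ≤ t) :
    b / √(1 + b ^ 2) * (t - s) ≤
      quantile (∫ x, Phi (b * (t - Metric.infDist x A))
        ∂ProbabilityTheory.stdGaussian (EuclideanSpace ℝ (Fin n))) -
      quantile (∫ x, Phi (b * (s - Metric.infDist x A))
        ∂ProbabilityTheory.stdGaussian (EuclideanSpace ℝ (Fin n))) := by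
  have hwc : ∀ s, Continuous fun x : EuclideanSpace ℝ (Fin n) => b * (s - Metric.infDist x A) :=
    fun s => continuous_const.mul (continuous_const.sub (Metric.continuous_infDist_pt A))
  have hfin : ∀ s, Integrable (fun x => Phi (b * (s - Metric.infDist x A)))
      (ProbabilityTheory.stdGaussian (EuclideanSpace ℝ (Fin n))) := fun s =>
    integrable_of_continuous_of_norm_le (C := 1) (continuous_Phi.comp (hwc s)) fun x => by
      rw [Real.norm_of_nonneg (Phi_pos _).le]; exact (Phi_lt_one _).le
  have hmem : ∀ s, ∫ x, Phi (b * (s - Metric.infDist x A))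
      ∂ProbabilityTheory.stdGaussian (EuclideanSpace ℝ (Fin n)) ∈ Ioo (0 : ℝ) 1 := fun s =>
    integral_mem_Ioo (hfin s) fun x => Phi_mem _
  have hder : ∀ s, HasDerivAt (fun s => ∫ x, Phi (b * (s - Metric.infDist x A))
      ∂ProbabilityTheory.stdGaussian (EuclideanSpace ℝ (Fin n)))
      (∫ x, gaussDensity (b * (s - Metric.infDist x A)) * b
        ∂ProbabilityTheory.stdGaussian (EuclideanSpace ℝ (Fin n))) s := fun s =>
    (hasDerivAt_integral_of_dominated_loc_of_deriv_le (bound := fun _ => b) (s := univ)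
      (F' := fun s x => gaussDensity (b * (s - Metric.infDist x A)) * b)
      univ_mem (.of_forall fun s => (hfin s).aestronglyMeasurable) (hfin s)
      ((continuous_gaussDensity.comp (hwc s)).mul continuous_const).aestronglyMeasurable
      (.of_forall fun x u _ => by
        rw [norm_mul, Real.norm_of_nonneg (gaussDensity_pos _).le, Real.norm_of_nonneg hb.le]
        exact mul_le_of_le_one_left hb.le (gaussDensity_le_one _))
      (integrable_const _)
      (.of_forall fun x u _ => by
        have h1 : HasDerivAt (fun u => b * (u - Metric.infDist x A)) b u := by
          simpa using ((hasDerivAt_id u).sub_const _).const_mul b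
        exact (hasDerivAt_Phi _).comp u h1)).2
  have hq := fun s => (hasDerivAt_quantile (hmem s)).comp s (hder s)
  refine mul_sub_le_image_sub_of_le_deriv (fun s => (hq s).differentiableAt) (fun s => ?_) hst
  rw [(hq s).deriv]
  have hB := isoProfile_integral_Phi_le (w := fun x => b * (s - Metric.infDist x A)) hb.le
    fun x y => by
      rw [← mul_sub, abs_mul, abs_of_pos hb, sub_sub_sub_cancel_left, ← dist_eq_norm, dist_comm]
      gcongr
      rw [← Real.dist_eq]
      simpa using (Metric.lipschitz_infDist_pt A).dist_le_mul y x
  have hpos := isoProfile_pos (∫ x, Phi (b * (s - Metric.infDist x A))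
    ∂ProbabilityTheory.stdGaussian (EuclideanSpace ℝ (Fin n)))
  rw [integral_mul_const]
  rw [isoProfile] at hB hpos
  have hr : 0 < √(1 + b ^ 2) := by positivity
  rw [inv_mul_eq_div, div_le_div_iff₀ hr hpos]
  nlinarith

/-- The Gaussian isoperimetric inequality for a pair of separated sets. -/
theorem stdGaussian_real_le_one_sub_Phi {A B : Set (EuclideanSpace ℝ (Fin n))}
    (hA : MeasurableSet A) (hB : MeasurableSet B) {r a : ℝ} (hr : 0 < r)
    (hAB : ∀ x ∈ A, ∀ y ∈ B, r ≤ ‖x - y‖)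
    (ha : Phi a ≤ (ProbabilityTheory.stdGaussian (EuclideanSpace ℝ (Fin n))).real A) :
    (ProbabilityTheory.stdGaussian (EuclideanSpace ℝ (Fin n))).real B ≤ 1 - Phi (a + r) := by
  set γ := ProbabilityTheory.stdGaussian (EuclideanSpace ℝ (Fin n)) with hγ
  have hAne : A.Nonempty := by
    rw [nonempty_iff_ne_empty]
    rintro rfl
    simp only [measureReal_empty] at ha
    exact (Phi_pos a).not_ge ha
  have hfin : ∀ b s, Integrable (fun x => Phi (b * (s - Metric.infDist x A))) γ := fun b s =>
    integrable_of_continuous_of_norm_le (C := 1) (continuous_Phi.comp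
      (continuous_const.mul (continuous_const.sub (Metric.continuous_infDist_pt A)))) fun x => by
      rw [Real.norm_of_nonneg (Phi_pos _).le]; exact (Phi_lt_one _).le
  have hlow : ∀ b s : ℝ, Phi a * Phi (b * s) ≤
      ∫ x, Phi (b * (s - Metric.infDist x A)) ∂γ := by
    intro b s
    calc Phi a * Phi (b * s) ≤ γ.real A * Phi (b * s) := by
          gcongr
          exact (Phi_pos _).le
      _ = ∫ x, A.indicator (fun _ => Phi (b * s)) x ∂γ := by
          rw [integral_indicator_const _ hA, smul_eq_mul]
      _ ≤ _ := by
          refine integral_mono ((integrable_const _).indicator hA) (hfin b s) fun x => ?_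
          by_cases hx : x ∈ A
          · simp [hx, Metric.infDist_zero_of_mem hx]
          · simpa [hx] using (Phi_pos _).le
  have hupp : ∀ b s : ℝ, 0 ≤ b → γ.real B * Phi (b * (r - s)) ≤
      1 - ∫ x, Phi (b * (s - Metric.infDist x A)) ∂γ := by
    intro b s hb
    calc γ.real B * Phi (b * (r - s)) = ∫ x, B.indicator (fun _ => Phi (b * (r - s))) x ∂γ := by
          rw [integral_indicator_const _ hB, smul_eq_mul]
      _ ≤ ∫ x, (1 - Phi (b * (s - Metric.infDist x A))) ∂γ := by
          refine integral_mono ((integrable_const _).indicator hB)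
            ((integrable_const _).sub (hfin b s)) fun x => ?_
          by_cases hx : x ∈ B
          · simp only [hx, indicator_of_mem]
            rw [← Phi_neg]
            refine strictMono_Phi.monotone ?_
            have : r ≤ Metric.infDist x A := (Metric.le_infDist hAne).2 fun y hy => by
              rw [dist_comm, dist_eq_norm]; exact hAB y hy x hx
            nlinarith
          · simpa [hx] using (Phi_lt_one _).le
      _ = _ := by
          rw [integral_sub (integrable_const _) (hfin b s)]
          simp
  have hN : Tendsto (fun N : ℕ => (N : ℝ)) atTop atTop := tendsto_natCast_atTop_atTop
  have hinv : Tendsto (fun N : ℕ => (N : ℝ)⁻¹) atTop (𝓝 0) := tendsto_inv_atTop_zero.comp hN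
  have hPN : Tendsto (fun N : ℕ => Phi N) atTop (𝓝 1) := tendsto_Phi_atTop.comp hN
  have hκ : Tendsto (fun N : ℕ => (N : ℝ) ^ 2 / √(1 + ((N : ℝ) ^ 2) ^ 2)) atTop (𝓝 1) := by
    have h1 : Tendsto (fun N : ℕ => (√(((N : ℝ)⁻¹) ^ 4 + 1))⁻¹) atTop (𝓝 1) := by
      have : Tendsto (fun N : ℕ => (√(((N : ℝ)⁻¹) ^ 4 + 1))⁻¹) atTop (𝓝 (√((0 : ℝ) ^ 4 + 1))⁻¹) :=
        ((Real.continuous_sqrt.tendsto _).comp ((hinv.pow 4).add_const 1)).inv₀ (by simp)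
      simpa using this
    refine h1.congr' ?_
    filter_upwards [eventually_gt_atTop 0] with N hN
    have hN0 : (0 : ℝ) < N := by exact_mod_cast hN
    have : 1 + ((N : ℝ) ^ 2) ^ 2 = ((N : ℝ) ^ 2) ^ 2 * (((N : ℝ)⁻¹) ^ 4 + 1) := by
      field_simp
    rw [this, Real.sqrt_mul (by positivity), Real.sqrt_sq (by positivity)]
    field_simp
  have hmain : ∀ᶠ N : ℕ in atTop, γ.real B * Phi N ≤ 1 - Phi (quantile (Phi a * Phi N) +
      (N : ℝ) ^ 2 / √(1 + ((N : ℝ) ^ 2) ^ 2) * (r - (N : ℝ)⁻¹ - (N : ℝ)⁻¹)) := by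
    filter_upwards [eventually_gt_atTop 0, hinv.eventually_lt_const (half_pos hr)] with N hN hNr
    have hN0 : (0 : ℝ) < N := by exact_mod_cast hN
    have hNN : (N : ℝ) ^ 2 * (N : ℝ)⁻¹ = N := by field_simp
    have h1 := hlow ((N : ℝ) ^ 2) (N : ℝ)⁻¹
    have h2 := hupp ((N : ℝ) ^ 2) (r - (N : ℝ)⁻¹) (by positivity)
    rw [sub_sub_cancel, hNN] at h2
    rw [hNN] at h1
    have h3 := quantile_integral_Phi_infDist_sub_le A (b := (N : ℝ) ^ 2) (by positivity)
      (s := (N : ℝ)⁻¹) (t := r - (N : ℝ)⁻¹) (by linarith)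
    rw [← hγ] at h3
    have hmem : ∀ b s, ∫ x, Phi (b * (s - Metric.infDist x A)) ∂γ ∈ Ioo (0 : ℝ) 1 := fun b s =>
      integral_mem_Ioo (hfin b s) fun x => Phi_mem _
    have h4 : quantile (Phi a * Phi N) ≤
        quantile (∫ x, Phi ((N : ℝ) ^ 2 * ((N : ℝ)⁻¹ - Metric.infDist x A)) ∂γ) :=
      strictMonoOn_quantile.monotoneOn
        ⟨mul_pos (Phi_pos _) (Phi_pos _), mul_lt_one_of_nonneg_of_lt_one_left (Phi_pos _).le
          (Phi_lt_one _) (Phi_lt_one _).le⟩ (hmem _ _) h1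
    refine h2.trans (sub_le_sub_left ?_ _)
    rw [← Phi_quantile (hmem ((N : ℝ) ^ 2) (r - (N : ℝ)⁻¹))]
    exact strictMono_Phi.monotone (by linarith)
  have hq : Tendsto (fun N : ℕ => quantile (Phi a * Phi N)) atTop (𝓝 a) := by
    have h1 : Tendsto (fun N : ℕ => Phi a * Phi N) atTop (𝓝 (Phi a)) := by
      simpa using hPN.const_mul (Phi a)
    have h2 := (continuousAt_quantile (Phi_mem a)).tendsto.comp h1
    rwa [quantile_Phi] at h2
  have hR : Tendsto (fun N : ℕ => 1 - Phi (quantile (Phi a * Phi N) +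
      (N : ℝ) ^ 2 / √(1 + ((N : ℝ) ^ 2) ^ 2) * (r - (N : ℝ)⁻¹ - (N : ℝ)⁻¹))) atTop
      (𝓝 (1 - Phi (a + r))) := by
    have h1 := hq.add (hκ.mul ((tendsto_const_nhds.sub hinv).sub hinv : Tendsto
      (fun N : ℕ => r - (N : ℝ)⁻¹ - (N : ℝ)⁻¹) atTop (𝓝 (r - 0 - 0))))
    simp only [sub_zero, one_mul] at h1
    exact ((continuous_Phi.tendsto _).comp h1).const_sub 1
  have hL : Tendsto (fun N : ℕ => γ.real B * Phi N) atTop (𝓝 (γ.real B)) := by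
    simpa using hPN.const_mul (γ.real B)
  exact le_of_tendsto_of_tendsto hL hR hmain

end

lemma Phi_sub_Phi_le_of_add_le {x y s : ℝ} (hyx : y ≤ x) (hs : 0 ≤ s) (h : x + y + s ≤ 0) :
    Phi x - Phi y ≤ Phi (x + s) - Phi (y + s) := by
  have key : ∀ {s : ℝ}, 0 ≤ s → x + y + 2 * s ≤ 0 →
      Phi x - Phi y ≤ Phi (x + s) - Phi (y + s) := by
    intro s hs h
    have := nonneg_of_hasDerivAt_nonneg
      (e := fun t => Phi (x + t) - Phi (y + t) - (Phi x - Phi y)) hs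
      (fun t _ => (((hasDerivAt_Phi (x + t)).comp_const_add x t).sub
        ((hasDerivAt_Phi (y + t)).comp_const_add y t)).sub_const _) (by simp)
      (fun t ht => sub_nonneg.2 (gaussDensity_le_of_sq_le (by nlinarith [ht.1, ht.2])))
    linarith
  rcases le_total (x + y + 2 * s) 0 with h' | h'
  · exact key hs h'
  · have h1 := key (s := -(x + y) - s) (by linarith) (by linarith)
    have e1 : Phi (x + (-(x + y) - s)) = 1 - Phi (y + s) := by rw [← Phi_neg]; congr 1; ring
    have e2 : Phi (y + (-(x + y) - s)) = 1 - Phi (x + s) := by rw [← Phi_neg]; congr 1; ring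
    rw [e1, e2] at h1
    linarith

/-- If enlarging a set of measure `p` by `r` obeys the Gaussian isoperimetric inequality against a
set of measure `q`, then `(p, q)` is far from `(Phi a, 1 - Phi a)`. -/
lemma Phi_sub_Phi_sub_le {a r p q : ℝ} (ha : a ≤ 0) (hr : 0 ≤ r)
    (hpq : ∀ b, Phi b ≤ p → q ≤ 1 - Phi (b + r)) :
    Phi a - Phi (a - r) ≤ |Phi a - p| + |1 - Phi a - q| := by
  rcases le_or_gt (Phi a) p with h | h
  · have h1 := hpq a h
    have h2 := Phi_sub_Phi_le_of_add_le (x := a) (y := a - r) (s := r) (by linarith) hr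
      (by linarith)
    rw [sub_add_cancel] at h2
    linarith [abs_nonneg (Phi a - p), le_abs_self (1 - Phi a - q)]
  · rcases le_or_gt p (Phi (a - r)) with h' | h'
    · linarith [abs_nonneg (1 - Phi a - q), le_abs_self (Phi a - p)]
    · have hp : p ∈ Ioo (0 : ℝ) 1 := ⟨(Phi_pos _).trans h', h.trans (Phi_lt_one _)⟩
      have hb := Phi_quantile hp
      set b := quantile p
      rw [← hb] at h h'
      have hba := strictMono_Phi.lt_iff_lt.1 h
      have hab := strictMono_Phi.lt_iff_lt.1 h'
      have h1 := hpq b hb.le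
      have h2 := Phi_sub_Phi_le_of_add_le (x := a) (y := a - r) (s := b - a + r) (by linarith)
        (by linarith) (by linarith)
      rw [show a + (b - a + r) = b + r by ring, show a - r + (b - a + r) = b by ring] at h2
      linarith [le_abs_self (1 - Phi a - q), le_abs_self (Phi a - p)]

lemma sum_abs_measureReal_sub_le_tvDist {Ω ι : Type*} [MeasurableSpace Ω] [Fintype ι]
    (P Q : Measure Ω) [IsFiniteMeasure P] [IsFiniteMeasure Q] {M : ι → Set Ω}
    (hM : ∀ i, MeasurableSet (M i)) (hd : Pairwise (Function.onFun Disjoint M)) :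
    ∑ i, |P.real (M i) - Q.real (M i)| ≤ tvDist P Q := by
  set s := P.toSignedMeasure - Q.toSignedMeasure with hs
  calc ∑ i, |P.real (M i) - Q.real (M i)| ≤ ∑ i, s.totalVariation.real (M i) := by
        refine Finset.sum_le_sum fun i _ => ?_
        have := SignedMeasure.norm_le_totalVariation s (M i)
        rwa [hs, sub_apply, Measure.toSignedMeasure_apply_measurable (hM i),
          Measure.toSignedMeasure_apply_measurable (hM i), Real.norm_eq_abs] at this
    _ = s.totalVariation.real (⋃ i, M i) := (measureReal_iUnion_fintype hd hM).symm
    _ ≤ tvDist P Q := measureReal_mono (subset_univ _)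

lemma stdGaussian_eq (n : ℕ) :
    _root_.stdGaussian n = ProbabilityTheory.stdGaussian (EuclideanSpace ℝ (Fin n)) :=
  map_pi_eq_stdGaussian

/-- Two sets separated by `D` have, for the image of a Gaussian measure under a `c`-Lipschitz map,
masses far from those of a probability vector `(Phi a, 1 - Phi a)` with `a ≤ 0`. -/
lemma Phi_sub_Phi_le_of_separated {n d : ℕ} {c D a : ℝ} (hc : 0 < c) (hD : 0 ≤ D) (ha : a ≤ 0)
    {G : EuclideanSpace ℝ (Fin n) → EuclideanSpace ℝ (Fin d)}
    (hG : ∀ x y, ‖G x - G y‖ ≤ c * ‖x - y‖) {S T : Set (EuclideanSpace ℝ (Fin d))}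
    (hS : MeasurableSet S) (hT : MeasurableSet T) (hST : ∀ x ∈ S, ∀ y ∈ T, D ≤ ‖x - y‖) :
    Phi a - Phi (a - D / c) ≤ |Phi a - ((_root_.stdGaussian n).map G).real S| +
      |1 - Phi a - ((_root_.stdGaussian n).map G).real T| := by
  have hGm : Measurable G := by
    refine (LipschitzWith.of_dist_le_mul (K := ⟨c, hc.le⟩) fun x y => ?_).continuous.measurable
    rw [dist_eq_norm, dist_eq_norm]
    exact hG x y
  rcases hD.eq_or_lt with rfl | hD
  · rw [zero_div, sub_zero, sub_self]
    positivity
  have hr : 0 < D / c := div_pos hD hc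
  rw [stdGaussian_eq, map_measureReal_apply hGm hS, map_measureReal_apply hGm hT]
  refine Phi_sub_Phi_sub_le ha hr.le fun b hb =>
    stdGaussian_real_le_one_sub_Phi (hGm hS) (hGm hT) hr (fun x hx y hy => ?_) hb
  rw [div_le_iff₀' hc]
  exact (hST _ hx _ hy).trans (hG x y)

end GaussIso

theorem mode_connecting_tv_lower_bound
    (n d k : ℕ) (hn : 1 ≤ n) (hd : 1 ≤ d) (hk : 2 ≤ k)
    (M : Fin k → Set (EuclideanSpace ℝ (Fin d)))
    (hMne : ∀ i, (M i).Nonempty)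
    (hMmeas : ∀ i, MeasurableSet (M i))
    (hMdisj : Pairwise (Function.onFun Disjoint M))
    -- `dsep i` is the distance of the manifold `M i` from the rest
    (dsep : Fin k → ℝ)
    (hdsep : ∀ i, dsep i =
      sInf {r : ℝ | ∃ x ∈ M i, ∃ j, j ≠ i ∧ ∃ y ∈ M j, r = ‖x - y‖})
    (Pdata : Measure (EuclideanSpace ℝ (Fin d))) [IsProbabilityMeasure Pdata]
    (hPdata : Pdata (⋃ i, M i) = 1)
    (π : Fin k → ℝ) (hπ : ∀ i, π i = (Pdata (M i)).toReal)
    (hπpos : ∀ i, 0 < π i) (hπlt : ∀ i, π i < 1)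
    (c : ℝ) (hc : 0 < c)
    (G : EuclideanSpace ℝ (Fin n) → EuclideanSpace ℝ (Fin d))
    (hG : ∀ x y, ‖G x - G y‖ ≤ c * ‖x - y‖)
    (Pmodel : Measure (EuclideanSpace ℝ (Fin d))) [IsProbabilityMeasure Pmodel]
    (hPmodel : Pmodel = (stdGaussian n).map G)
    (p : Fin k → ℝ) (hp : ∀ i, p i = (Pmodel (M i)).toReal)
    (πstar : Fin k → ℝ) (hπstar : ∀ i, πstar i = min (π i) (1 - π i))
    (a : Fin k → ℝ) (ha : ∀ i, Phi (a i) = πstar i)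
    (δ : ℝ) (hδ : δ = ⨆ i : Fin k, (πstar i - Phi (a i - dsep i / c))) :
    (∑ i : Fin k, |π i - p i|) ≤ tvDist Pdata Pmodel ∧
      δ ≤ ∑ i : Fin k, |π i - p i| := by
  subst hδ
  have : Nonempty (Fin k) := ⟨⟨0, by omega⟩⟩
  have hsum : ∑ i, |π i - p i| = ∑ i, |Pdata.real (M i) - Pmodel.real (M i)| := by
    simp only [hπ, hp, measureReal_def]
  refine ⟨hsum ▸ GaussIso.sum_abs_measureReal_sub_le_tvDist Pdata Pmodel hMmeas hMdisj,
    ciSup_le fun i => ?_⟩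
  set S := {r : ℝ | ∃ x ∈ M i, ∃ j, j ≠ i ∧ ∃ y ∈ M j, r = ‖x - y‖} with hS
  set T := ⋃ j ∈ Finset.univ.erase i, M j with hT
  have hTm : MeasurableSet T := Finset.measurableSet_biUnion _ fun j _ => hMmeas j
  have hS0 : ∀ r ∈ S, 0 ≤ r := by
    rintro r ⟨x, -, j, -, y, -, rfl⟩
    exact norm_nonneg _
  have hD : 0 ≤ dsep i := by
    rw [hdsep i]
    exact Real.sInf_nonneg hS0
  have hsep : ∀ x ∈ M i, ∀ y ∈ T, dsep i ≤ ‖x - y‖ := by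
    intro x hx y hy
    simp only [hT, Set.mem_iUnion, Finset.mem_erase, exists_prop] at hy
    obtain ⟨j, ⟨hj, -⟩, hy⟩ := hy
    rw [hdsep i]
    exact csInf_le ⟨0, hS0⟩ ⟨x, hx, j, hj, y, hy, rfl⟩
  have hsep' : ∀ x ∈ T, ∀ y ∈ M i, dsep i ≤ ‖x - y‖ := fun x hx y hy => by
    rw [norm_sub_rev]
    exact hsep y hy x hx
  have hq : Pmodel.real T = ∑ j ∈ Finset.univ.erase i, p j := by
    rw [hT, measureReal_biUnion_finset (fun j _ l _ h => hMdisj h) fun j _ => hMmeas j]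
    simp only [hp, measureReal_def]
  have hπ1 : ∑ j, π j = 1 := by
    simp only [hπ]
    rw [← ENNReal.toReal_one, ← hPdata]
    exact (measureReal_iUnion_fintype hMdisj hMmeas).symm
  have hrest : |1 - π i - Pmodel.real T| ≤ ∑ j ∈ Finset.univ.erase i, |π j - p j| := by
    rw [hq, ← hπ1, ← Finset.add_sum_erase _ _ (Finset.mem_univ i), add_sub_cancel_left,
      ← Finset.sum_sub_distrib]
    exact Finset.abs_sum_le_sum_abs _ _
  rw [← Finset.add_sum_erase _ _ (Finset.mem_univ i)]
  refine le_trans ?_ (add_le_add_right hrest _)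
  have hpi : p i = Pmodel.real (M i) := hp i
  have ha0 : a i ≤ 0 := by
    rw [← GaussIso.strictMono_Phi.le_iff_le, ha i, hπstar i, GaussIso.Phi_zero]
    rcases le_total (π i) (1 / 2) with h | h
    · exact (min_le_left _ _).trans h
    · exact (min_le_right _ _).trans (by linarith)
  rw [hpi, ← ha i]
  rcases le_total (π i) (1 - π i) with h | h
  · have hai : Phi (a i) = π i := by rw [ha, hπstar, min_eq_left h]
    have := GaussIso.Phi_sub_Phi_le_of_separated hc hD ha0 hG (hMmeas i) hTm hsep
    rw [← hPmodel] at this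
    rwa [← hai]
  · have hai : Phi (a i) = 1 - π i := by rw [ha, hπstar, min_eq_right h]
    have := GaussIso.Phi_sub_Phi_le_of_separated hc hD ha0 hG hTm (hMmeas i) hsep'
    rw [← hPmodel, hai, sub_sub_cancel, add_comm] at this
    rwa [hai]
end

section
/- Let n ≥ 1, let U be a Borel subset of ℝⁿ, let r ≥ 0, and let a ∈ ℝ satisfy Φ(a) ≤ γ_n(U). Then Φ(a + r) ≤ γ_n(U_r), where U_r is the r-thickening of U. -/
open MeasureTheory ProbabilityTheory

/-- The `r`-thickening of a set `U`: the Minkowski sum of `U` with the closed ball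
of radius `r` centered at the origin. -/
def thick {n : ℕ} (U : Set (EuclideanSpace ℝ (Fin n))) (r : ℝ) :
    Set (EuclideanSpace ℝ (Fin n)) :=
  {x | ∃ u ∈ U, ‖x - u‖ ≤ r}

open Filter Topology

/-- The standard normal density. -/
noncomputable def phi (x : ℝ) : ℝ :=
  (2 * Real.pi) ^ (-(1 : ℝ) / 2) * Real.exp (-x ^ 2 / 2)

lemma phi_eq_gaussianPDFReal : phi = gaussianPDFReal 0 1 := by
  ext x
  simp only [phi, gaussianPDFReal, NNReal.coe_one, mul_one, sub_zero]
  congr 1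
  rw [Real.sqrt_eq_rpow, ← Real.rpow_neg (by positivity)]
  norm_num

lemma phi_pos (x : ℝ) : 0 < phi x := by
  unfold phi; positivity

lemma phi_neg (x : ℝ) : phi (-x) = phi x := by
  simp [phi]

lemma continuous_phi : Continuous phi := by
  unfold phi; fun_prop

lemma hasDerivAt_phi (x : ℝ) : HasDerivAt phi (-x * phi x) x := by
  have h : HasDerivAt (fun x : ℝ => -x ^ 2 / 2) (-x) x := by
    convert! ((hasDerivAt_pow 2 x).neg).div_const 2 using 1
    simp; ring
  convert! (h.exp).const_mul ((2 * Real.pi) ^ (-(1 : ℝ) / 2)) using 1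
  simp only [phi]; ring

lemma phi_le_of_sq_le {x y : ℝ} (h : y ^ 2 ≤ x ^ 2) : phi x ≤ phi y := by
  unfold phi; gcongr

lemma phi_le_one (x : ℝ) : phi x ≤ 1 := by
  unfold phi
  have h1 : (2 * Real.pi) ^ (-(1 : ℝ) / 2) ≤ 1 :=
    Real.rpow_le_one_of_one_le_of_nonpos (by linarith [Real.pi_gt_three]) (by norm_num)
  have h2 : Real.exp (-x ^ 2 / 2) ≤ 1 := Real.exp_le_one_iff.2 (by nlinarith [sq_nonneg x])
  exact mul_le_one₀ h1 (Real.exp_nonneg _) h2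

lemma integrable_phi : Integrable phi := by
  rw [phi_eq_gaussianPDFReal]; exact integrable_gaussianPDFReal 0 1

lemma Phi_eq_cdf (x : ℝ) : Phi x = cdf (gaussianReal 0 1) x := by
  rw [cdf_eq_real, measureReal_def, gaussianReal_apply_eq_integral _ one_ne_zero,
    ENNReal.toReal_ofReal (integral_nonneg fun t => gaussianPDFReal_nonneg 0 1 t),
    ← phi_eq_gaussianPDFReal]
  rfl

lemma hasDerivAt_Phi (x : ℝ) : HasDerivAt Phi (phi x) x := by
  have h : ∀ y, Phi y = Phi 0 + ∫ t in (0 : ℝ)..y, phi t := fun y => by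
    rw [← intervalIntegral.integral_Iic_sub_Iic integrable_phi.integrableOn
      integrable_phi.integrableOn]
    simp only [Phi, phi]; ring
  rw [show Phi = fun y => Phi 0 + ∫ t in (0 : ℝ)..y, phi t from funext h]
  exact (intervalIntegral.integral_hasDerivAt_right
    (continuous_phi.intervalIntegrable _ _)
    (continuous_phi.stronglyMeasurableAtFilter _ _) continuous_phi.continuousAt).const_add _

lemma continuous_Phi : Continuous Phi :=
  continuous_iff_continuousAt.2 fun x => (hasDerivAt_Phi x).continuousAt

lemma strictMono_Phi : StrictMono Phi :=
  strictMono_of_hasDerivAt_pos hasDerivAt_Phi phi_pos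

lemma tendsto_Phi_atTop : Tendsto Phi atTop (𝓝 1) := by
  rw [funext Phi_eq_cdf]; exact tendsto_cdf_atTop _

lemma tendsto_Phi_atBot : Tendsto Phi atBot (𝓝 0) := by
  rw [funext Phi_eq_cdf]; exact tendsto_cdf_atBot _

lemma Phi_mem_Ioo (x : ℝ) : Phi x ∈ Set.Ioo (0 : ℝ) 1 := by
  have h0 (y : ℝ) : 0 ≤ Phi y := by rw [Phi_eq_cdf]; exact cdf_nonneg _ _
  have h1 (y : ℝ) : Phi y ≤ 1 := by rw [Phi_eq_cdf]; exact cdf_le_one _ _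
  exact ⟨(h0 (x - 1)).trans_lt (strictMono_Phi (by linarith)),
    (strictMono_Phi (by linarith : x < x + 1)).trans_le (h1 _)⟩

lemma Phi_neg (x : ℝ) : Phi (-x) = 1 - Phi x := by
  have hd : ∀ y, HasDerivAt (fun y => Phi (-y) + Phi y) 0 y := fun y => by
    have h := ((hasDerivAt_Phi (-y)).comp y (hasDerivAt_neg y)).add (hasDerivAt_Phi y)
    convert! h using 1
    rw [phi_neg]; ring
  have hc : ∀ y, Phi (-y) + Phi y = Phi (-x) + Phi x := fun y =>
    is_const_of_deriv_eq_zero (fun y => (hd y).differentiableAt) (fun y => (hd y).deriv) y x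
  have hl : Tendsto (fun y => Phi (-y) + Phi y) atTop (𝓝 (0 + 1)) :=
    (tendsto_Phi_atBot.comp tendsto_neg_atTop_atBot).add tendsto_Phi_atTop
  have := tendsto_nhds_unique hl ((tendsto_const_nhds).congr fun y => (hc y).symm)
  linarith

lemma exists_Phi_eq {p : ℝ} (hp : p ∈ Set.Ioo (0 : ℝ) 1) : ∃ x, Phi x = p :=
  mem_range_of_exists_le_of_exists_ge continuous_Phi
    ((tendsto_Phi_atBot.eventually (eventually_le_nhds hp.1)).exists)
    ((tendsto_Phi_atTop.eventually (eventually_ge_nhds hp.2)).exists)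

/-- The quantile function of the standard normal distribution. -/
noncomputable def PhiInv : ℝ → ℝ := Function.invFun Phi

lemma PhiInv_Phi (x : ℝ) : PhiInv (Phi x) = x :=
  Function.leftInverse_invFun strictMono_Phi.injective x

lemma Phi_PhiInv {p : ℝ} (hp : p ∈ Set.Ioo (0 : ℝ) 1) : Phi (PhiInv p) = p := by
  obtain ⟨x, rfl⟩ := exists_Phi_eq hp
  rw [PhiInv_Phi]

lemma PhiInv_strictMonoOn : StrictMonoOn PhiInv (Set.Ioo 0 1) := fun p hp q hq h => by
  rwa [← strictMono_Phi.lt_iff_lt, Phi_PhiInv hp, Phi_PhiInv hq]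

lemma PhiInv_one_sub {p : ℝ} (hp : p ∈ Set.Ioo (0 : ℝ) 1) : PhiInv (1 - p) = -PhiInv p := by
  obtain ⟨x, rfl⟩ := exists_Phi_eq hp
  rw [← Phi_neg, PhiInv_Phi, PhiInv_Phi]

lemma hasDerivAt_PhiInv {p : ℝ} (hp : p ∈ Set.Ioo (0 : ℝ) 1) :
    HasDerivAt PhiInv (phi (PhiInv p))⁻¹ p := by
  have hn : Set.Ioo (0 : ℝ) 1 ∈ 𝓝 p := Ioo_mem_nhds hp.1 hp.2
  refine HasDerivAt.of_local_left_inverse ?_ (hasDerivAt_Phi _) (phi_pos _).ne' ?_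
  · refine PhiInv_strictMonoOn.continuousAt_of_image_mem_nhds hn ?_
    convert! (univ_mem : (Set.univ : Set ℝ) ∈ 𝓝 (PhiInv p))
    exact Set.eq_univ_of_forall fun x => ⟨Phi x, Phi_mem_Ioo x, PhiInv_Phi x⟩
  · filter_upwards [hn] with q hq using Phi_PhiInv hq

/-- The Gaussian isoperimetric profile. -/
noncomputable def isoProfile (p : ℝ) : ℝ := phi (PhiInv p)

lemma isoProfile_pos (p : ℝ) : 0 < isoProfile p := phi_pos _

lemma isoProfile_Phi (x : ℝ) : isoProfile (Phi x) = phi x := by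
  rw [isoProfile, PhiInv_Phi]

lemma hasDerivAt_isoProfile {p : ℝ} (hp : p ∈ Set.Ioo (0 : ℝ) 1) :
    HasDerivAt isoProfile (-PhiInv p) p := by
  convert! (hasDerivAt_phi (PhiInv p)).comp p (hasDerivAt_PhiInv hp) using 1
  have := (phi_pos (PhiInv p)).ne'
  field_simp

lemma hasDerivAt_isoProfile_sq {p : ℝ} (hp : p ∈ Set.Ioo (0 : ℝ) 1) :
    HasDerivAt (fun q => isoProfile q ^ 2) (-2 * (isoProfile p * PhiInv p)) p := by
  convert! (hasDerivAt_isoProfile hp).pow 2 using 1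
  push_cast; ring

lemma hasDerivAt_isoProfile_mul_PhiInv {p : ℝ} (hp : p ∈ Set.Ioo (0 : ℝ) 1) :
    HasDerivAt (fun q => isoProfile q * PhiInv q) (1 - PhiInv p ^ 2) p := by
  convert! (hasDerivAt_isoProfile hp).mul (hasDerivAt_PhiInv hp) using 1
  have := (phi_pos (PhiInv p)).ne'
  simp only [isoProfile]
  field_simp
  ring

lemma nonneg_of_hasDerivAt_nonneg {g g' : ℝ → ℝ} {X : ℝ} (hX : 0 ≤ X) (h0 : 0 ≤ g 0)
    (hg : ∀ t ∈ Set.Icc 0 X, HasDerivAt g (g' t) t) (hg' : ∀ t ∈ Set.Icc 0 X, 0 ≤ g' t) :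
    0 ≤ g X := by
  have hm : MonotoneOn g (Set.Icc 0 X) := by
    refine monotoneOn_of_deriv_nonneg (convex_Icc 0 X)
      (fun t ht => (hg t ht).continuousAt.continuousWithinAt) ?_ ?_ <;>
    · intro t ht
      have ht' := interior_subset ht
      first
        | exact (hg t ht').differentiableAt.differentiableWithinAt
        | (rw [(hg t ht').deriv]; exact hg' t ht')
  exact h0.trans (hm ⟨le_rfl, hX⟩ ⟨hX, le_rfl⟩ hX)

lemma monotone_div_phi : Monotone fun x => x / phi x := by
  have hd : ∀ x, HasDerivAt (fun x => x / phi x) ((1 + x ^ 2) / phi x) x := fun x => by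
    convert! (hasDerivAt_id x).div (hasDerivAt_phi x) (phi_pos x).ne' using 1
    have := (phi_pos x).ne'
    simp only [id]
    field_simp
    ring
  refine monotone_of_deriv_nonneg (fun x => (hd x).differentiableAt) fun x => ?_
  rw [(hd x).deriv]
  have := phi_pos x
  positivity

lemma two_mul_PhiInv_sq_le {c t : ℝ} (ht : 0 ≤ t) (h0 : 0 < c - t) (h1 : c + t < 1) :
    2 * PhiInv c ^ 2 ≤ PhiInv (c + t) ^ 2 + PhiInv (c - t) ^ 2 := by
  have key := nonneg_of_hasDerivAt_nonneg
    (g := fun s => PhiInv (c + s) ^ 2 + PhiInv (c - s) ^ 2 - 2 * PhiInv c ^ 2)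
    (g' := fun s => 2 * (PhiInv (c + s) / phi (PhiInv (c + s))
      - PhiInv (c - s) / phi (PhiInv (c - s)))) ht (by simp; linarith) ?_ ?_
  · simpa using key
  · rintro s ⟨hs0, hs1⟩
    have hp := ((hasDerivAt_PhiInv (p := c + s) ⟨by linarith, by linarith⟩).comp_const_add c s).pow 2
    have hm := ((hasDerivAt_PhiInv (p := c - s) ⟨by linarith, by linarith⟩).comp_const_sub c s).pow 2
    convert! (hp.add hm).sub_const (2 * PhiInv c ^ 2) using 1
    simp only [Nat.cast_ofNat, Nat.add_one_sub_one, pow_one, div_eq_mul_inv]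
    ring
  · rintro s ⟨hs0, hs1⟩
    have := monotone_div_phi (PhiInv_strictMonoOn.monotoneOn (a := c - s) (b := c + s)
      ⟨by linarith, by linarith⟩ ⟨by linarith, by linarith⟩ (by linarith))
    simp only at this
    linarith

lemma PhiInv_sq_le_of_le_half {c t : ℝ} (hc : c ≤ 1 / 2) (ht : 0 ≤ t) (h0 : 0 < c - t) :
    PhiInv (c + t) ^ 2 ≤ PhiInv (c - t) ^ 2 := by
  have hm : c - t ∈ Set.Ioo (0 : ℝ) 1 := ⟨h0, by linarith⟩
  have hp : c + t ∈ Set.Ioo (0 : ℝ) 1 := ⟨by linarith, by linarith⟩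
  have h1 := PhiInv_strictMonoOn.monotoneOn hm hp (by linarith)
  have h2 := PhiInv_strictMonoOn.monotoneOn hp
    (b := 1 - (c - t)) ⟨by linarith, by linarith⟩ (by linarith)
  rw [PhiInv_one_sub hm] at h2
  nlinarith

/-- Second order lower bound for the symmetric difference of the squared profile. -/
lemma isoProfile_sq_second_difference {c x : ℝ} (hx : 0 ≤ x) (h0 : 0 < c - x) (h1 : c + x < 1) :
    2 * x ^ 2 * PhiInv c ^ 2 ≤
      isoProfile (c + x) ^ 2 + isoProfile (c - x) ^ 2 - 2 * isoProfile c ^ 2 + 2 * x ^ 2 := by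
  have hslope : ∀ t ∈ Set.Icc 0 x, 0 ≤
      -2 * (isoProfile (c + t) * PhiInv (c + t)) + 2 * (isoProfile (c - t) * PhiInv (c - t))
        + 4 * t - 4 * t * PhiInv c ^ 2 := by
    rintro t ⟨ht0, ht1⟩
    refine nonneg_of_hasDerivAt_nonneg
      (g := fun t => -2 * (isoProfile (c + t) * PhiInv (c + t))
        + 2 * (isoProfile (c - t) * PhiInv (c - t)) + 4 * t - 4 * t * PhiInv c ^ 2)
      (g' := fun t => 2 * (PhiInv (c + t) ^ 2 + PhiInv (c - t) ^ 2 - 2 * PhiInv c ^ 2))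
      ht0 (by simp) ?_ ?_
    · rintro s ⟨hs0, hs1⟩
      have hp := ((hasDerivAt_isoProfile_mul_PhiInv (p := c + s)
        ⟨by linarith, by linarith⟩).comp_const_add c s).const_mul (-2)
      have hm := ((hasDerivAt_isoProfile_mul_PhiInv (p := c - s)
        ⟨by linarith, by linarith⟩).comp_const_sub c s).const_mul 2
      have hl := (hasDerivAt_id s).const_mul 4
      convert! ((hp.add hm).add hl).sub (hl.mul_const (PhiInv c ^ 2)) using 1
      ring
    · rintro s ⟨hs0, hs1⟩
      have := two_mul_PhiInv_sq_le hs0 (c := c) (by linarith) (by linarith)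
      linarith
  have key := nonneg_of_hasDerivAt_nonneg
    (g := fun t => isoProfile (c + t) ^ 2 + isoProfile (c - t) ^ 2 - 2 * isoProfile c ^ 2
      + 2 * t ^ 2 - 2 * t ^ 2 * PhiInv c ^ 2)
    (g' := fun t => -2 * (isoProfile (c + t) * PhiInv (c + t))
      + 2 * (isoProfile (c - t) * PhiInv (c - t)) + 4 * t - 4 * t * PhiInv c ^ 2)
    hx (by simp; linarith) ?_ hslope
  · linarith
  · rintro s ⟨hs0, hs1⟩
    have hp := (hasDerivAt_isoProfile_sq (p := c + s)
      ⟨by linarith, by linarith⟩).comp_const_add c s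
    have hm := (hasDerivAt_isoProfile_sq (p := c - s)
      ⟨by linarith, by linarith⟩).comp_const_sub c s
    have hl := (hasDerivAt_pow 2 s).const_mul 2
    convert! (((hp.add hm).sub_const (2 * isoProfile c ^ 2)).add hl).sub
      (hl.mul_const (PhiInv c ^ 2)) using 1
    simp
    ring

/-- First order upper bound for the squared profile on the increasing half. -/
lemma isoProfile_sq_difference_le {c x : ℝ} (hc : c ≤ 1 / 2) (hx : 0 ≤ x) (h0 : 0 < c - x) :
    isoProfile (c + x) ^ 2 - isoProfile (c - x) ^ 2 ≤ -4 * x * (isoProfile c * PhiInv c) := by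
  have hslope : ∀ t ∈ Set.Icc 0 x, 0 ≤
      2 * (isoProfile (c + t) * PhiInv (c + t)) + 2 * (isoProfile (c - t) * PhiInv (c - t))
        - 4 * (isoProfile c * PhiInv c) := by
    rintro t ⟨ht0, ht1⟩
    refine nonneg_of_hasDerivAt_nonneg
      (g := fun t => 2 * (isoProfile (c + t) * PhiInv (c + t))
        + 2 * (isoProfile (c - t) * PhiInv (c - t)) - 4 * (isoProfile c * PhiInv c))
      (g' := fun t => 2 * (PhiInv (c - t) ^ 2 - PhiInv (c + t) ^ 2))
      ht0 (by simp; linarith) ?_ ?_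
    · rintro s ⟨hs0, hs1⟩
      have hp := ((hasDerivAt_isoProfile_mul_PhiInv (p := c + s)
        ⟨by linarith, by linarith⟩).comp_const_add c s).const_mul 2
      have hm := ((hasDerivAt_isoProfile_mul_PhiInv (p := c - s)
        ⟨by linarith, by linarith⟩).comp_const_sub c s).const_mul 2
      convert! (hp.add hm).sub_const (4 * (isoProfile c * PhiInv c)) using 1
      ring
    · rintro s ⟨hs0, hs1⟩
      have := PhiInv_sq_le_of_le_half hc hs0 (by linarith)
      linarith
  have key := nonneg_of_hasDerivAt_nonneg
    (g := fun t => isoProfile (c - t) ^ 2 - isoProfile (c + t) ^ 2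
      - 4 * (isoProfile c * PhiInv c) * t)
    (g' := fun t => 2 * (isoProfile (c + t) * PhiInv (c + t))
      + 2 * (isoProfile (c - t) * PhiInv (c - t)) - 4 * (isoProfile c * PhiInv c))
    hx (by simp) ?_ hslope
  · linarith
  · rintro s ⟨hs0, hs1⟩
    have hp := (hasDerivAt_isoProfile_sq (p := c + s)
      ⟨by linarith, by linarith⟩).comp_const_add c s
    have hm := (hasDerivAt_isoProfile_sq (p := c - s)
      ⟨by linarith, by linarith⟩).comp_const_sub c s
    convert! (hm.sub hp).sub
      ((hasDerivAt_id s).const_mul (4 * (isoProfile c * PhiInv c))) using 1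
    ring

lemma isoProfile_one_sub {p : ℝ} (hp : p ∈ Set.Ioo (0 : ℝ) 1) :
    isoProfile (1 - p) = isoProfile p := by
  rw [isoProfile, PhiInv_one_sub hp, phi_neg, isoProfile]

/-- **Bobkov's two-point inequality**, in centered form. -/
lemma isoProfile_two_point_centered {c x : ℝ} (hx : 0 ≤ x) (h0 : 0 < c - x) (h1 : c + x < 1) :
    2 * isoProfile c ≤ √(isoProfile (c + x) ^ 2 + x ^ 2) + √(isoProfile (c - x) ^ 2 + x ^ 2) := by
  wlog hc : c ≤ 1 / 2 generalizing c
  · have := this (c := 1 - c) (by linarith) (by linarith) (by linarith)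
    rw [show 1 - c + x = 1 - (c - x) by ring, show 1 - c - x = 1 - (c + x) by ring,
      isoProfile_one_sub ⟨by linarith, by linarith⟩, isoProfile_one_sub ⟨by linarith, by linarith⟩,
      isoProfile_one_sub ⟨by linarith, by linarith⟩] at this
    linarith
  have hA := isoProfile_sq_second_difference hx h0 h1
  have hB := isoProfile_sq_difference_le hc hx h0
  have hC : isoProfile (c - x) ≤ isoProfile (c + x) :=
    phi_le_of_sq_le (PhiInv_sq_le_of_le_half hc hx h0)
  have hp := isoProfile_pos (c + x)
  have hm := isoProfile_pos (c - x)
  have h := isoProfile_pos c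
  have hC' : 0 ≤ isoProfile (c + x) ^ 2 - isoProfile (c - x) ^ 2 := by nlinarith
  have hD : (isoProfile (c + x) ^ 2 - isoProfile (c - x) ^ 2) ^ 2 ≤
      8 * isoProfile c ^ 2 * (2 * x ^ 2 * PhiInv c ^ 2) := by
    calc _ ≤ (-4 * x * (isoProfile c * PhiInv c)) ^ 2 := pow_le_pow_left₀ hC' hB 2
      _ = _ := by ring
  have hE := hD.trans (mul_le_mul_of_nonneg_left hA (by positivity))
  set P := √(isoProfile (c + x) ^ 2 + x ^ 2) with hP
  set Q := √(isoProfile (c - x) ^ 2 + x ^ 2) with hQ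
  have hP2 : P ^ 2 = isoProfile (c + x) ^ 2 + x ^ 2 := Real.sq_sqrt (by positivity)
  have hQ2 : Q ^ 2 = isoProfile (c - x) ^ 2 + x ^ 2 := Real.sq_sqrt (by positivity)
  have hP0 : 0 ≤ P := Real.sqrt_nonneg _
  have hQ0 : 0 ≤ Q := Real.sqrt_nonneg _
  rw [show isoProfile (c + x) ^ 2 = P ^ 2 - x ^ 2 by linarith,
    show isoProfile (c - x) ^ 2 = Q ^ 2 - x ^ 2 by linarith] at hE
  by_contra! hlt
  have hs : (P + Q) ^ 2 < 4 * isoProfile c ^ 2 := by nlinarith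
  have hd : (P - Q) ^ 2 < 4 * isoProfile c ^ 2 := by nlinarith [mul_nonneg hP0 hQ0]
  have := mul_pos (sub_pos.2 hs) (sub_pos.2 hd)
  nlinarith

/-- **Bobkov's two-point inequality**. -/
lemma isoProfile_two_point {a b : ℝ} (ha : a ∈ Set.Ioo (0 : ℝ) 1) (hb : b ∈ Set.Ioo (0 : ℝ) 1) :
    isoProfile ((a + b) / 2) ≤
      (√(isoProfile a ^ 2 + ((a - b) / 2) ^ 2) + √(isoProfile b ^ 2 + ((a - b) / 2) ^ 2)) / 2 := by
  wlog hab : b ≤ a generalizing a b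
  · have := this hb ha (by linarith)
    rw [add_comm b a, ← neg_sub a b, neg_div, neg_sq] at this
    linarith
  have := isoProfile_two_point_centered (c := (a + b) / 2) (x := (a - b) / 2)
    (by linarith) (by linarith [hb.1]) (by linarith [ha.2])
  rw [show (a + b) / 2 + (a - b) / 2 = a by ring,
    show (a + b) / 2 - (a - b) / 2 = b by ring] at this
  linarith

section WalkMean

variable {E F : Type*} [AddCommGroup E] [AddCommGroup F] [Module ℝ F]

/-- The mean of `f` at the end point of the random walk started at the origin whose steps are
`± h`, with independent fair signs, for `h` running through the list. -/
noncomputable def walkMean : List E → (E → F) → F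
  | [], f => f 0
  | h :: l, f => (1 / 2 : ℝ) • (walkMean l (fun z => f (z + h)) + walkMean l (fun z => f (z - h)))

lemma walkMean_mono (l : List E) {f g : E → ℝ} (hfg : ∀ z, f z ≤ g z) :
    walkMean l f ≤ walkMean l g := by
  induction l generalizing f g with
  | nil => exact hfg 0
  | cons h l ih =>
    have h1 := ih fun z => hfg (z + h)
    have h2 := ih fun z => hfg (z - h)
    simp only [walkMean, smul_eq_mul]
    linarith

lemma walkMean_sub (l : List E) (f g : E → F) :
    walkMean l (fun z => f z - g z) = walkMean l f - walkMean l g := by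
  induction l generalizing f g with
  | nil => rfl
  | cons h l ih =>
    simp only [walkMean, ih, ← smul_sub]
    congr 1; abel

lemma walkMean_smul (l : List E) (c : ℝ) (f : E → F) :
    walkMean l (fun z => c • f z) = c • walkMean l f := by
  induction l generalizing f with
  | nil => rfl
  | cons h l ih =>
    simp only [walkMean, ih, ← smul_add]
    rw [smul_comm]

lemma walkMean_mem_Ioo (l : List E) {f : E → ℝ} {m M : ℝ} (hf : ∀ z, f z ∈ Set.Ioo m M) :
    walkMean l f ∈ Set.Ioo m M := by
  induction l generalizing f with
  | nil => exact hf 0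
  | cons h l ih =>
    have h1 := ih fun z => hf (z + h)
    have h2 := ih fun z => hf (z - h)
    simp only [walkMean, smul_eq_mul, Set.mem_Ioo] at *
    constructor <;> linarith

lemma sqrt_add_sq_add_le (a b c d : ℝ) :
    √((a + c) ^ 2 + (b + d) ^ 2) ≤ √(a ^ 2 + b ^ 2) + √(c ^ 2 + d ^ 2) := by
  have h1 := Real.sq_sqrt (by positivity : 0 ≤ a ^ 2 + b ^ 2)
  have h2 := Real.sq_sqrt (by positivity : 0 ≤ c ^ 2 + d ^ 2)
  have h3 : a * c + b * d ≤ √(a ^ 2 + b ^ 2) * √(c ^ 2 + d ^ 2) := by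
    rw [← Real.sqrt_mul (by positivity)]
    exact Real.le_sqrt_of_sq_le (by nlinarith [sq_nonneg (a * d - b * c)])
  exact Real.sqrt_le_iff.2 ⟨by positivity, by nlinarith⟩

/-- The triangle inequality for the mean of a plane vector. -/
lemma sqrt_walkMean_sq_add_sq_le (l : List E) (f g : E → ℝ) :
    √(walkMean l f ^ 2 + walkMean l g ^ 2) ≤ walkMean l fun z => √(f z ^ 2 + g z ^ 2) := by
  induction l generalizing f g with
  | nil => rfl
  | cons h l ih =>
    have h1 := ih (fun z => f (z + h)) (fun z => g (z + h))
    have h2 := ih (fun z => f (z - h)) (fun z => g (z - h))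
    simp only [walkMean, smul_eq_mul]
    rw [mul_pow, mul_pow, ← mul_add, Real.sqrt_mul (by positivity),
      Real.sqrt_sq (by norm_num)]
    have := sqrt_add_sq_add_le (walkMean l fun z => f (z + h)) (walkMean l fun z => g (z + h))
      (walkMean l fun z => f (z - h)) (walkMean l fun z => g (z - h))
    linarith

/-- **Bobkov's inequality** for a random walk: here `d h` bounds the discrete derivatives of `f`
along the step `h`. -/
lemma isoProfile_walkMean_le (l : List E) {f : E → ℝ} {d : E → E → ℝ}
    (hf : ∀ z, f z ∈ Set.Ioo (0 : ℝ) 1)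
    (hp : ∀ h ∈ l, ∀ z, |f (z + (2 : ℕ) • h) - f z| / 2 ≤ d h z)
    (hm : ∀ h ∈ l, ∀ z, |f (z - (2 : ℕ) • h) - f z| / 2 ≤ d h z) :
    isoProfile (walkMean l f) ≤
      walkMean l fun z => √(isoProfile (f z) ^ 2 + (l.map fun h => d h z ^ 2).sum) := by
  induction l generalizing f d with
  | nil => simp [walkMean, Real.sqrt_sq (isoProfile_pos _).le]
  | cons h l ih =>
    have one_side : ∀ k : E, (k = h ∨ k = -h) →
        √(isoProfile (walkMean l fun z => f (z + k)) ^ 2 +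
          (((walkMean l fun z => f (z + k)) - walkMean l fun z => f (z - k)) / 2) ^ 2) ≤
        walkMean l fun z => √(isoProfile (f (z + k)) ^ 2 +
          ((h :: l).map fun h => d h (z + k) ^ 2).sum) := by
      intro k hk
      have hI := ih (f := fun z => f (z + k)) (d := fun h z => d h (z + k)) (fun z => hf _)
        (fun h' hh' z => by
          simpa only [add_right_comm] using hp h' (List.mem_cons_of_mem _ hh') (z + k))
        (fun h' hh' z => by
          simpa only [sub_add_eq_add_sub] using hm h' (List.mem_cons_of_mem _ hh') (z + k))
      have hD : |(walkMean l fun z => f (z + k)) - walkMean l fun z => f (z - k)| / 2 ≤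
          walkMean l fun z => d h (z + k) := by
        have hd : ∀ z, |f (z + k) - f (z - k)| / 2 ≤ d h (z + k) := by
          intro z
          rcases hk with rfl | rfl
          · have := hm k List.mem_cons_self (z + k)
            rw [abs_sub_comm, two_nsmul, add_sub_add_right_eq_sub] at this
            exact this
          · have := hp h List.mem_cons_self (z + -h)
            rw [abs_sub_comm, two_nsmul, add_assoc, neg_add_cancel_left] at this
            simpa using this
        have h1 := walkMean_mono l (f := fun z => f (z + k) - f (z - k))
          (g := fun z => 2 * d h (z + k)) fun z => by
            linarith [hd z, le_abs_self (f (z + k) - f (z - k))]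
        have h2 := walkMean_mono l (f := fun z => f (z - k) - f (z + k))
          (g := fun z => 2 * d h (z + k)) fun z => by
            linarith [hd z, neg_abs_le (f (z + k) - f (z - k))]
        have h3 : (walkMean l fun z => 2 * d h (z + k)) = 2 * walkMean l fun z => d h (z + k) := by
          simpa using walkMean_smul l (2 : ℝ) fun z => d h (z + k)
        rw [walkMean_sub, h3] at h1 h2
        have := abs_le.2 ⟨by linarith, h1⟩
        linarith
      calc _ ≤ √((walkMean l fun z => √(isoProfile (f (z + k)) ^ 2 +
              (l.map fun h => d h (z + k) ^ 2).sum)) ^ 2 +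
              (walkMean l fun z => d h (z + k)) ^ 2) := by
            refine Real.sqrt_le_sqrt (add_le_add (pow_le_pow_left₀ (isoProfile_pos _).le hI 2) ?_)
            rw [sq_le_sq, abs_div, abs_two]
            exact hD.trans (le_abs_self _)
        _ ≤ _ := sqrt_walkMean_sq_add_sq_le l _ _
        _ = _ := by
            congr 1; ext z
            have : 0 ≤ (l.map fun h => d h (z + k) ^ 2).sum :=
              List.sum_nonneg (by simp only [List.mem_map]; rintro _ ⟨x, -, rfl⟩; positivity)
            rw [Real.sq_sqrt (by positivity)]
            simp only [List.map_cons, List.sum_cons]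
            congr 1; ring
    have h1 := one_side h (Or.inl rfl)
    have h2 := one_side (-h) (Or.inr rfl)
    simp only [sub_neg_eq_add, ← sub_eq_add_neg] at h2
    rw [← neg_sub (walkMean l fun z => f (z + h)), neg_div, neg_sq] at h2
    have h3 := isoProfile_two_point (walkMean_mem_Ioo l fun z => hf (z + h))
      (walkMean_mem_Ioo l fun z => hf (z - h))
    simp only [walkMean, smul_eq_mul]
    rw [one_div, inv_mul_eq_div]
    linarith

end WalkMean

section WalkLaw

open scoped ENNReal

variable {E : Type*} [NormedAddCommGroup E] [MeasurableSpace E] [BorelSpace E]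

/-- The law of the end point of the random walk whose steps are `± h`, with independent fair
signs, for `h` running through the list. -/
noncomputable def walkLaw : List E → Measure E
  | [] => Measure.dirac 0
  | h :: l => (2⁻¹ : ℝ≥0∞) • ((walkLaw l).map (· + h) + (walkLaw l).map (· - h))

instance isProbabilityMeasure_walkLaw (l : List E) : IsProbabilityMeasure (walkLaw l) := by
  induction l with
  | nil => unfold walkLaw; infer_instance
  | cons h l ih =>
    constructor
    simp only [walkLaw, Measure.smul_apply, Measure.add_apply, smul_eq_mul]
    rw [Measure.map_apply (by fun_prop) .univ, Measure.map_apply (by fun_prop) .univ]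
    simp only [Set.preimage_univ, measure_univ]
    rw [one_add_one_eq_two]
    exact ENNReal.inv_mul_cancel two_ne_zero ENNReal.ofNat_ne_top

lemma integrable_walkLaw_and_integral {F : Type*} [NormedAddCommGroup F] [NormedSpace ℝ F]
    [CompleteSpace F] [SecondCountableTopologyEither E F] (l : List E) {f : E → F}
    (hf : Continuous f) :
    Integrable f (walkLaw l) ∧ ∫ z, f z ∂(walkLaw l) = walkMean l f := by
  induction l generalizing f with
  | nil =>
    exact ⟨integrable_dirac (by simp), by simp [walkLaw, walkMean]⟩
  | cons h l ih =>
    have h1 := ih (f := fun z => f (z + h)) (by fun_prop)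
    have h2 := ih (f := fun z => f (z - h)) (by fun_prop)
    have i1 : Integrable f ((walkLaw l).map (· + h)) :=
      (integrable_map_measure hf.aestronglyMeasurable (by fun_prop)).2 h1.1
    have i2 : Integrable f ((walkLaw l).map (· - h)) :=
      (integrable_map_measure hf.aestronglyMeasurable (by fun_prop)).2 h2.1
    refine ⟨(i1.add_measure i2).smul_measure (by simp), ?_⟩
    simp only [walkLaw, walkMean]
    rw [integral_smul_measure, integral_add_measure i1 i2,
      integral_map (by fun_prop) hf.aestronglyMeasurable,
      integral_map (by fun_prop) hf.aestronglyMeasurable, h1.2, h2.2]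
    simp

lemma integral_walkLaw {F : Type*} [NormedAddCommGroup F] [NormedSpace ℝ F]
    [CompleteSpace F] [SecondCountableTopologyEither E F] (l : List E) {f : E → F}
    (hf : Continuous f) : ∫ z, f z ∂(walkLaw l) = walkMean l f :=
  (integrable_walkLaw_and_integral l hf).2

lemma charFun_walkLaw [InnerProductSpace ℝ E] (l : List E) (t : E) :
    charFun (walkLaw l) t = (l.map fun h => (Real.cos (inner ℝ h t) : ℂ)).prod := by
  rw [charFun_apply, integral_walkLaw l (by fun_prop)]
  suffices h : ∀ c : ℂ, walkMean l (fun z => c * Complex.exp (inner ℝ z t * Complex.I)) =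
      c * (l.map fun h => (Real.cos (inner ℝ h t) : ℂ)).prod by simpa using h 1
  induction l with
  | nil => intro c; simp [walkMean]
  | cons h l ih =>
    intro c
    simp only [walkMean, List.map_cons, List.prod_cons]
    have h1 : ∀ z : E, c * Complex.exp (inner ℝ (z + h) t * Complex.I) =
        c * Complex.exp (inner ℝ h t * Complex.I) * Complex.exp (inner ℝ z t * Complex.I) := by
      intro z
      rw [inner_add_left, mul_assoc, ← Complex.exp_add]
      push_cast; ring_nf
    have h2 : ∀ z : E, c * Complex.exp (inner ℝ (z - h) t * Complex.I) =
        c * Complex.exp (-inner ℝ h t * Complex.I) * Complex.exp (inner ℝ z t * Complex.I) := by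
      intro z
      rw [inner_sub_left, mul_assoc, ← Complex.exp_add]
      push_cast; ring_nf
    simp_rw [h1, h2, ih, Complex.real_smul, Complex.ofReal_cos, Complex.cos]
    push_cast
    ring

lemma tendsto_cos_inv_sqrt_mul_pow (t : ℝ) :
    Tendsto (fun N : ℕ => (Real.cos ((√N)⁻¹ * t) : ℂ) ^ N) atTop
      (𝓝 (Complex.exp (-t ^ 2 / 2))) := by
  have h := tendsto_charFun_inv_sqrt_mul_pow (P := walkLaw [(1 : ℝ)]) (X := id)
    aemeasurable_id ?_ ?_ t
  · simpa [charFun_walkLaw] using h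
  · simp only [id]
    rw [integral_walkLaw _ continuous_id']
    simp [walkMean]
  · simp only [Pi.pow_apply, id]
    rw [integral_walkLaw _ (by fun_prop)]
    simp [walkMean]; norm_num

end WalkLaw

/-- The `N` steps of length `N ^ (-1/2)` along each vector of the standard basis. -/
noncomputable def basisSteps (n N : ℕ) : List (EuclideanSpace ℝ (Fin n)) :=
  (List.finRange n).flatMap fun i =>
    List.replicate N ((√N)⁻¹ • EuclideanSpace.single i (1 : ℝ))

lemma sum_map_flatMap_replicate {α M : Type*} [AddCommMonoid M] {n N : ℕ} (v : Fin n → α)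
    (g : α → M) :
    (((List.finRange n).flatMap fun i => List.replicate N (v i)).map g).sum =
      ∑ i, N • g (v i) := by
  rw [← List.sum_ofFn, List.ofFn_eq_map]
  induction List.finRange n with
  | nil => rfl
  | cons a l ih => simp [ih]

lemma prod_map_flatMap_replicate {α M : Type*} [CommMonoid M] {n N : ℕ} (v : Fin n → α)
    (g : α → M) :
    (((List.finRange n).flatMap fun i => List.replicate N (v i)).map g).prod =
      ∏ i, g (v i) ^ N := by
  rw [← List.prod_ofFn, List.ofFn_eq_map]
  induction List.finRange n with
  | nil => rfl
  | cons a l ih => simp [ih]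

lemma stdGaussian_eq (n : ℕ) :
    _root_.stdGaussian n = ProbabilityTheory.stdGaussian (EuclideanSpace ℝ (Fin n)) := by
  rw [← map_pi_eq_stdGaussian]; rfl

instance isProbabilityMeasure_euclidean_stdGaussian (n : ℕ) :
    IsProbabilityMeasure (_root_.stdGaussian n) := by
  rw [stdGaussian_eq]; infer_instance

/-- The central limit theorem for the random walk along the standard basis. -/
lemma tendsto_walkMean_basisSteps (n : ℕ) {g : EuclideanSpace ℝ (Fin n) → ℝ}
    (hg : Continuous g) {C : ℝ} (hC : ∀ z, |g z| ≤ C) :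
    Tendsto (fun N => walkMean (basisSteps n N) g) atTop
      (𝓝 (∫ z, g z ∂(_root_.stdGaussian n))) := by
  let μ (N : ℕ) : ProbabilityMeasure (EuclideanSpace ℝ (Fin n)) :=
    ⟨walkLaw (basisSteps n N), inferInstance⟩
  let γ : ProbabilityMeasure (EuclideanSpace ℝ (Fin n)) := ⟨_root_.stdGaussian n, inferInstance⟩
  have hlim : Tendsto μ atTop (𝓝 γ) := by
    refine ProbabilityMeasure.tendsto_iff_tendsto_charFun.2 fun t => ?_
    simp only [μ, γ, ProbabilityMeasure.coe_mk]
    rw [stdGaussian_eq, charFun_stdGaussian, ← Complex.ofReal_pow,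
      EuclideanSpace.norm_sq_eq]
    simp_rw [charFun_walkLaw, basisSteps, prod_map_flatMap_replicate, inner_smul_left,
      EuclideanSpace.inner_single_left]
    have h := tendsto_finsetProd (Finset.univ : Finset (Fin n)) fun i _ =>
      tendsto_cos_inv_sqrt_mul_pow (t i)
    rw [← Complex.exp_sum, ← Finset.sum_div, Finset.sum_neg_distrib] at h
    simpa using h
  have := ProbabilityMeasure.tendsto_iff_forall_integral_tendsto.1 hlim
    (BoundedContinuousFunction.ofNormedAddCommGroup g hg C hC)
  simpa [μ, γ, integral_walkLaw _ hg] using this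

section Functional

variable {n : ℕ} {w : EuclideanSpace ℝ (Fin n) → ℝ}

lemma sum_sq_apply_single (ℓ : EuclideanSpace ℝ (Fin n) →L[ℝ] ℝ) :
    ∑ i, ℓ (EuclideanSpace.single i 1) ^ 2 = ‖ℓ‖ ^ 2 := by
  obtain ⟨x, rfl⟩ := (InnerProductSpace.toDual ℝ (EuclideanSpace ℝ (Fin n))).surjective ℓ
  rw [LinearIsometryEquiv.norm_map, EuclideanSpace.norm_sq_eq]
  simp [EuclideanSpace.inner_single_right]

lemma integral_mem_Ioo_of_mem_Icc {α : Type*} [MeasurableSpace α] {μ : Measure α}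
    [IsProbabilityMeasure μ] {f : α → ℝ} {a b m M : ℝ} (hf : Integrable f μ)
    (h : ∀ x, f x ∈ Set.Icc m M) (ha : a < m) (hb : M < b) :
    ∫ x, f x ∂μ ∈ Set.Ioo a b := by
  have h1 := integral_mono (μ := μ) (integrable_const m) hf fun x => (h x).1
  have h2 := integral_mono (μ := μ) hf (integrable_const M) fun x => (h x).2
  simp only [integral_const, probReal_univ, one_smul] at h1 h2
  exact ⟨ha.trans_le h1, h2.trans_lt hb⟩

lemma integrable_Phi_comp (hw : Continuous w) :
    Integrable (fun z => Phi (w z)) (_root_.stdGaussian n) :=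
  .of_bound (continuous_Phi.comp hw).aestronglyMeasurable 1 <| .of_forall fun z => by
    rw [Real.norm_eq_abs, abs_of_pos (Phi_mem_Ioo _).1]
    exact (Phi_mem_Ioo _).2.le

lemma integrable_phi_comp (hw : Continuous w) :
    Integrable (fun z => phi (w z)) (_root_.stdGaussian n) :=
  .of_bound (continuous_phi.comp hw).aestronglyMeasurable 1 <| .of_forall fun z => by
    rw [Real.norm_eq_abs, abs_of_pos (phi_pos _)]
    exact phi_le_one _

lemma integral_Phi_mem_Ioo (hw : Continuous w) {M : ℝ} (hM : ∀ z, |w z| ≤ M) :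
    ∫ z, Phi (w z) ∂(_root_.stdGaussian n) ∈ Set.Ioo (0 : ℝ) 1 :=
  integral_mem_Ioo_of_mem_Icc (integrable_Phi_comp hw)
    (fun z => ⟨strictMono_Phi.monotone (abs_le.1 (hM z)).1,
      strictMono_Phi.monotone (abs_le.1 (hM z)).2⟩) (Phi_mem_Ioo (-M)).1 (Phi_mem_Ioo M).2

/-- A discrete derivative is controlled by the derivative at the base point. -/
lemma abs_sub_div_two_le {E : Type*} [NormedAddCommGroup E] [NormedSpace ℝ E] {f : E → ℝ}
    (hf : Differentiable ℝ f) {ε δ : ℝ}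
    (hδ : ∀ x y, dist x y < δ → ‖fderiv ℝ f x - fderiv ℝ f y‖ ≤ ε) {h : E} (hh : 2 * ‖h‖ < δ)
    (z : E) : |f (z + (2 : ℕ) • h) - f z| / 2 ≤ |fderiv ℝ f z h| + ε * ‖h‖ := by
  have h2 : ‖(2 : ℕ) • h‖ = 2 * ‖h‖ := by
    rw [← Nat.cast_smul_eq_nsmul ℝ, norm_smul]; norm_num
  have hpos : 0 < δ := lt_of_le_of_lt (by positivity) hh
  have hball : z + (2 : ℕ) • h ∈ Metric.ball z δ := by
    rw [Metric.mem_ball, dist_eq_norm, add_sub_cancel_left, h2]; exact hh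
  have key := (convex_ball z δ).norm_image_sub_le_of_norm_fderiv_le'
    (fun x _ => hf x) (fun x hx => hδ x z hx) (Metric.mem_ball_self hpos) hball
  rw [add_sub_cancel_left, h2, map_nsmul, Real.norm_eq_abs] at key
  have := abs_le.1 key
  have h3 := abs_le.1 (le_refl |fderiv ℝ f z h|)
  simp only [nsmul_eq_mul, Nat.cast_ofNat] at this
  have : |f (z + (2 : ℕ) • h) - f z| ≤ 2 * (|fderiv ℝ f z h| + ε * ‖h‖) :=
    abs_le.2 ⟨by linarith, by linarith⟩
  linarith

/-- **Bobkov's functional inequality** for the Gaussian measure and the function `Phi ∘ w`, with a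
uniform bound on the gradient of `w`. -/
lemma isoProfile_integral_Phi_le (hw : ContDiff ℝ 1 w) {M L : ℝ} (hM : ∀ z, |w z| ≤ M)
    (hL : ∀ z, ‖fderiv ℝ w z‖ ≤ L) (hcs : HasCompactSupport (fderiv ℝ w)) :
    isoProfile (∫ z, Phi (w z) ∂(_root_.stdGaussian n)) ≤
      √(1 + L ^ 2) * ∫ z, phi (w z) ∂(_root_.stdGaussian n) := by
  have hL0 : 0 ≤ L := (norm_nonneg _).trans (hL 0)
  set f : EuclideanSpace ℝ (Fin n) → ℝ := fun z => Phi (w z) with hf_def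
  have hf' : ∀ z, HasFDerivAt f (phi (w z) • fderiv ℝ w z) z := fun z =>
    (hasDerivAt_Phi (w z)).comp_hasFDerivAt z
      (hw.differentiable one_ne_zero z).hasFDerivAt
  have hfd : fderiv ℝ f = fun z => phi (w z) • fderiv ℝ w z := funext fun z => (hf' z).fderiv
  have huc : UniformContinuous (fderiv ℝ f) := by
    rw [hfd]
    exact (HasCompactSupport.smul_left hcs).uniformContinuous_of_continuous
      ((continuous_phi.comp hw.continuous).smul (hw.continuous_fderiv one_ne_zero))
  have hstep : ∀ ε > 0, ∀ᶠ N in atTop, isoProfile (walkMean (basisSteps n N) f) ≤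
      walkMean (basisSteps n N) fun z => √(1 + L ^ 2) * phi (w z) + n * ε := by
    intro ε hε
    obtain ⟨δ, hδ, hδ'⟩ := Metric.uniformContinuous_iff.1 huc ε hε
    have ht : Tendsto (fun N : ℕ => 2 * (√N)⁻¹) atTop (𝓝 (2 * 0)) :=
      (tendsto_inv_atTop_zero.comp <| Real.tendsto_sqrt_atTop.comp
        tendsto_natCast_atTop_atTop).const_mul 2
    rw [mul_zero] at ht
    filter_upwards [ht.eventually_lt_const hδ, eventually_gt_atTop 0] with N hN hN0
    have hnorm : ∀ i : Fin n, ‖(√N)⁻¹ • EuclideanSpace.single i (1 : ℝ)‖ = (√N)⁻¹ := fun i => by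
      simp [norm_smul, abs_of_nonneg]
    have hmem : ∀ h ∈ basisSteps n N, 2 * ‖h‖ < δ := by
      intro h hh
      simp only [basisSteps, List.mem_flatMap, List.mem_replicate] at hh
      obtain ⟨i, -, -, rfl⟩ := hh
      rwa [hnorm]
    have hδ'' : ∀ x y, dist x y < δ → ‖fderiv ℝ f x - fderiv ℝ f y‖ ≤ ε := fun x y hxy => by
      rw [← dist_eq_norm]; exact (hδ' hxy).le
    have hdiff : Differentiable ℝ f := fun z => (hf' z).differentiableAt
    refine (isoProfile_walkMean_le (basisSteps n N) (f := f)
      (d := fun h z => |fderiv ℝ f z h| + ε * ‖h‖) (fun z => Phi_mem_Ioo _)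
      (fun h hh z => abs_sub_div_two_le hdiff hδ'' (hmem h hh) z)
      (fun h hh z => ?_)).trans (walkMean_mono _ fun z => ?_)
    · have := abs_sub_div_two_le hdiff hδ'' (h := -h) (by simpa using hmem h hh) z
      simpa [← sub_eq_add_neg] using this
    · rw [basisSteps, sum_map_flatMap_replicate]
      have hN' : (0 : ℝ) < N := Nat.cast_pos.2 hN0
      have hsum : (∑ i : Fin n, N • (|fderiv ℝ f z ((√N)⁻¹ • EuclideanSpace.single i (1 : ℝ))| +
          ε * ‖(√N)⁻¹ • EuclideanSpace.single i (1 : ℝ)‖) ^ 2) =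
          ∑ i : Fin n, (|fderiv ℝ f z (EuclideanSpace.single i (1 : ℝ))| + ε) ^ 2 := by
        refine Finset.sum_congr rfl fun i _ => ?_
        rw [hnorm, map_smul, smul_eq_mul, abs_mul, abs_of_nonneg (by positivity : 0 ≤ (√N)⁻¹),
          nsmul_eq_mul, mul_comm ε, ← mul_add, mul_pow, inv_pow, Real.sq_sqrt hN'.le, ← mul_assoc,
          mul_inv_cancel₀ hN'.ne', one_mul]
      rw [hsum]
      set B := L * phi (w z) with hB
      have hp := phi_pos (w z)
      have hB0 : 0 ≤ B := by positivity
      have hnB : ‖fderiv ℝ f z‖ ≤ B := by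
        rw [hfd, norm_smul, Real.norm_eq_abs, abs_of_pos hp, mul_comm]
        exact mul_le_mul_of_nonneg_right (hL z) hp.le
      have hb : ∀ i : Fin n, |fderiv ℝ f z (EuclideanSpace.single i (1 : ℝ))| ≤ B := fun i => by
        have := (fderiv ℝ f z).le_opNorm (EuclideanSpace.single i (1 : ℝ))
        rw [PiLp.norm_single, norm_one, mul_one, Real.norm_eq_abs] at this
        exact this.trans hnB
      have hn : (n : ℝ) ≤ (n : ℝ) ^ 2 := by
        exact_mod_cast Nat.le_self_pow two_ne_zero n
      have hs : (∑ i : Fin n, (|fderiv ℝ f z (EuclideanSpace.single i (1 : ℝ))| + ε) ^ 2) ≤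
          (B + n * ε) ^ 2 := by
        calc _ ≤ ∑ i : Fin n, (fderiv ℝ f z (EuclideanSpace.single i (1 : ℝ)) ^ 2 +
              (2 * B * ε + ε ^ 2)) := by
              refine Finset.sum_le_sum fun i _ => ?_
              have := hb i
              rw [add_sq, sq_abs]
              nlinarith
          _ = ‖fderiv ℝ f z‖ ^ 2 + n * (2 * B * ε + ε ^ 2) := by
              rw [Finset.sum_add_distrib, sum_sq_apply_single]
              simp; ring
          _ ≤ B ^ 2 + (2 * B * (n * ε) + (n : ℝ) ^ 2 * ε ^ 2) := by
              have h1 := pow_le_pow_left₀ (norm_nonneg _) hnB 2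
              have h2 := mul_le_mul_of_nonneg_right hn (sq_nonneg ε)
              linarith
          _ = _ := by ring
      rw [hf_def, isoProfile_Phi]
      calc _ ≤ √((phi (w z) + 0) ^ 2 + (B + n * ε) ^ 2) := by
            rw [add_zero]; exact Real.sqrt_le_sqrt (by linarith)
        _ ≤ √(phi (w z) ^ 2 + B ^ 2) + √(0 ^ 2 + (n * ε) ^ 2) := sqrt_add_sq_add_le _ _ _ _
        _ = _ := by
            rw [hB, show phi (w z) ^ 2 + (L * phi (w z)) ^ 2 = (1 + L ^ 2) * phi (w z) ^ 2 by ring,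
              Real.sqrt_mul (by positivity), Real.sqrt_sq hp.le, zero_pow two_ne_zero, zero_add,
              Real.sqrt_sq (by positivity)]
  have hI01 := integral_Phi_mem_Ioo hw.continuous hM
  have hbound : ∀ ε > 0, isoProfile (∫ z, Phi (w z) ∂(_root_.stdGaussian n)) ≤
      √(1 + L ^ 2) * (∫ z, phi (w z) ∂(_root_.stdGaussian n)) + n * ε := by
    intro ε hε
    have hl := (hasDerivAt_isoProfile hI01).continuousAt.tendsto.comp
      (tendsto_walkMean_basisSteps n (continuous_Phi.comp hw.continuous) (C := 1) fun z => by
        rw [abs_of_pos (Phi_mem_Ioo _).1]; exact (Phi_mem_Ioo _).2.le)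
    have hr := tendsto_walkMean_basisSteps n
      (g := fun z => √(1 + L ^ 2) * phi (w z) + n * ε)
      (((continuous_phi.comp hw.continuous).const_mul _).add continuous_const)
      (C := √(1 + L ^ 2) + n * ε) fun z => by
        have := phi_pos (w z)
        rw [abs_of_nonneg (by positivity)]
        have := mul_le_mul_of_nonneg_left (phi_le_one (w z)) (Real.sqrt_nonneg (1 + L ^ 2))
        linarith
    rw [integral_add ((integrable_phi_comp hw.continuous).const_mul _) (integrable_const _),
      integral_const_mul] at hr
    simp only [integral_const, probReal_univ, one_smul] at hr
    exact le_of_tendsto_of_tendsto hl hr (hstep ε hε)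
  refine le_of_forall_pos_le_add fun ε hε => ?_
  refine (hbound (ε / (n + 1)) (by positivity)).trans ?_
  gcongr
  rw [mul_div_assoc', div_le_iff₀ (by positivity)]
  nlinarith

end Functional

section Translation

variable {n : ℕ} {w : EuclideanSpace ℝ (Fin n) → ℝ}

lemma hasDerivAt_integral_Phi_add (hw : Continuous w) (s : ℝ) :
    HasDerivAt (fun s => ∫ z, Phi (w z + s) ∂(_root_.stdGaussian n))
      (∫ z, phi (w z + s) ∂(_root_.stdGaussian n)) s := by
  refine (hasDerivAt_integral_of_dominated_loc_of_deriv_le (bound := fun _ => 1)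
    (s := Set.univ) (F := fun s z => Phi (w z + s)) (F' := fun s z => phi (w z + s))
    univ_mem (.of_forall fun t => ?_) (integrable_Phi_comp (by fun_prop)) ?_ ?_
    (integrable_const _) ?_).2
  · exact (integrable_Phi_comp (w := fun z => w z + t) (by fun_prop)).aestronglyMeasurable
  · exact (integrable_phi_comp (w := fun z => w z + s) (by fun_prop)).aestronglyMeasurable
  · exact .of_forall fun z t _ => by
      rw [Real.norm_eq_abs, abs_of_pos (phi_pos _)]; exact phi_le_one _
  · exact .of_forall fun z t _ => (hasDerivAt_Phi _).comp_const_add (w z) t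

/-- Adding a constant to `w` increases the quantile of `∫ Phi ∘ w` at least at the rate
`(1 + L ^ 2) ^ (-1/2)`. -/
lemma PhiInv_integral_Phi_add_le (hw : ContDiff ℝ 1 w) {M L : ℝ} (hM : ∀ z, |w z| ≤ M)
    (hL : ∀ z, ‖fderiv ℝ w z‖ ≤ L) (hcs : HasCompactSupport (fderiv ℝ w)) {s : ℝ} (hs : 0 ≤ s) :
    PhiInv (∫ z, Phi (w z) ∂(_root_.stdGaussian n)) + s / √(1 + L ^ 2) ≤
      PhiInv (∫ z, Phi (w z + s) ∂(_root_.stdGaussian n)) := by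
  set F : ℝ → ℝ := fun s => ∫ z, Phi (w z + s) ∂(_root_.stdGaussian n) with hF
  have hF01 : ∀ t, F t ∈ Set.Ioo (0 : ℝ) 1 := fun t =>
    integral_Phi_mem_Ioo (w := fun z => w z + t) (hw.continuous.add continuous_const)
      (M := M + |t|) fun z => (abs_add_le _ _).trans (by linarith [hM z])
  have hd : ∀ t, HasDerivAt (fun t => PhiInv (F t) - PhiInv (F 0) - t * (1 / √(1 + L ^ 2)))
      ((phi (PhiInv (F t)))⁻¹ * (∫ z, phi (w z + t) ∂(_root_.stdGaussian n))
        - 1 / √(1 + L ^ 2)) t := fun t => by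
    have := ((hasDerivAt_PhiInv (hF01 t)).comp t
      (hasDerivAt_integral_Phi_add hw.continuous t)).sub_const (PhiInv (F 0))
    convert! this.sub ((hasDerivAt_id t).mul_const (1 / √(1 + L ^ 2))) using 1
    ring
  have key := nonneg_of_hasDerivAt_nonneg hs (by simp) (fun t _ => hd t) fun t _ => by
    have hfd : fderiv ℝ (fun z => w z + t) = fderiv ℝ w := funext fun z => fderiv_add_const t
    have h := isoProfile_integral_Phi_le (w := fun z => w z + t) (L := L)
      (hw.add contDiff_const) (M := M + |t|)
      (fun z => (abs_add_le _ _).trans (by linarith [hM z]))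
      (fun z => by rw [hfd]; exact hL z) (by rw [hfd]; exact hcs)
    have hp := phi_pos (PhiInv (F t))
    have hq : 0 < √(1 + L ^ 2) := Real.sqrt_pos.2 (by positivity)
    rw [sub_nonneg, inv_mul_eq_div, div_le_div_iff₀ hq hp, one_mul, mul_comm]
    exact h
  simp only [hF, add_zero] at key
  rw [mul_one_div] at key
  linarith

end Translation

section Mollification

variable {n : ℕ}

open ContinuousLinearMap in
/-- Smooth approximation of a compactly supported Lipschitz function. -/
lemma exists_contDiff_approx {v : EuclideanSpace ℝ (Fin n) → ℝ} (hv : LipschitzWith 1 v)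
    (hcs : HasCompactSupport v) {δ : ℝ} (hδ : 0 < δ) :
    ∃ u : EuclideanSpace ℝ (Fin n) → ℝ, ContDiff ℝ 1 u ∧ HasCompactSupport u ∧
      (∀ z, ‖fderiv ℝ u z‖ ≤ 1) ∧ ∀ z, |u z - v z| ≤ δ := by
  let b : ContDiffBump (0 : EuclideanSpace ℝ (Fin n)) := ⟨δ / 2, δ, by positivity, by linarith⟩
  have hc := hv.continuous
  have hex : ConvolutionExists (b.normed volume) v (lsmul ℝ ℝ) volume :=
    (b.hasCompactSupport_normed (μ := volume)).convolutionExists_left _ (b.continuous_normed (μ := volume))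
      hc.locallyIntegrable
  refine ⟨MeasureTheory.convolution (b.normed volume) v (lsmul ℝ ℝ) volume, ?_, ?_, ?_, ?_⟩
  · exact (b.hasCompactSupport_normed (μ := volume)).contDiff_convolution_left _ (b.contDiff_normed (μ := volume))
      hc.locallyIntegrable
  · exact (b.hasCompactSupport_normed (μ := volume)).convolution _ hcs
  · intro z
    refine (norm_fderiv_le_of_lipschitz ℝ (C := 1) (LipschitzWith.of_dist_le_mul
      fun x y => ?_)).trans (by simp)
    simp only [MeasureTheory.convolution, NNReal.coe_one, one_mul, lsmul_apply, smul_eq_mul]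
    have hx := hex x
    have hy := hex y
    simp only [ConvolutionExistsAt, lsmul_apply, smul_eq_mul] at hx hy
    rw [dist_eq_norm, ← integral_sub hx hy]
    calc _ ≤ ∫ t, b.normed volume t * dist x y := by
          have hbi : Integrable (fun t => b.normed volume t * dist x y) :=
            b.integrable_normed.mul_const _
          refine norm_integral_le_of_norm_le hbi (.of_forall fun t => ?_)
          rw [← mul_sub, norm_mul, Real.norm_eq_abs, abs_of_nonneg (b.nonneg_normed t)]
          refine mul_le_mul_of_nonneg_left ?_ (b.nonneg_normed t)
          simpa [dist_eq_norm] using hv.dist_le_mul (x - t) (y - t)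
      _ = _ := by rw [integral_mul_const, b.integral_normed, one_mul]
  · intro z
    rw [← Real.dist_eq]
    refine b.dist_normed_convolution_le hc.aestronglyMeasurable fun x hx => ?_
    have := hv.dist_le_mul x z
    rw [NNReal.coe_one, one_mul] at this
    exact this.trans (Metric.mem_ball.1 hx).le

end Mollification

section Limit

variable {n : ℕ}

lemma tendsto_div_sqrt_one_add_sq : Tendsto (fun L : ℝ => L / √(1 + L ^ 2)) atTop (𝓝 1) := by
  have h : Tendsto (fun L : ℝ => (√((L ^ 2)⁻¹ + 1))⁻¹) atTop (𝓝 (√(0 + 1))⁻¹) := by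
    have h1 := (tendsto_inv_atTop_zero.comp (tendsto_pow_atTop (α := ℝ) two_ne_zero)).add_const 1
    exact ((Real.continuous_sqrt.tendsto _).comp h1).inv₀ (by simp)
  rw [zero_add, Real.sqrt_one, inv_one] at h
  refine h.congr' ?_
  filter_upwards [eventually_gt_atTop 0] with L hL
  have : 1 + L ^ 2 = L ^ 2 * ((L ^ 2)⁻¹ + 1) := by field_simp
  rw [this, Real.sqrt_mul (by positivity), Real.sqrt_sq hL.le]
  field_simp

/-- Lower bound for `∫ Phi ∘ w` when `w` is large on a set. -/
lemma Phi_mul_measure_le_integral {w : EuclideanSpace ℝ (Fin n) → ℝ} (hw : Continuous w)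
    {K : Set (EuclideanSpace ℝ (Fin n))} (hK : MeasurableSet K) {c : ℝ} (hc : ∀ z ∈ K, c ≤ w z) :
    Phi c * (_root_.stdGaussian n K).toReal ≤ ∫ z, Phi (w z) ∂(_root_.stdGaussian n) := by
  calc _ = ∫ z, K.indicator (fun _ => Phi c) z ∂(_root_.stdGaussian n) := by
        rw [integral_indicator_const _ hK, smul_eq_mul, mul_comm, Measure.real]
    _ ≤ _ := integral_mono ((integrable_const _).indicator hK) (integrable_Phi_comp hw)
        fun z => Set.indicator_apply_le' (fun hz => strictMono_Phi.monotone (hc z hz))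
          fun _ => (Phi_mem_Ioo _).1.le

/-- Upper bound for `∫ Phi ∘ w` when `w` is small off a set. -/
lemma integral_Phi_le_measure_add {w : EuclideanSpace ℝ (Fin n) → ℝ} (hw : Continuous w)
    {A : Set (EuclideanSpace ℝ (Fin n))} (hA : MeasurableSet A) {c : ℝ} (hc : ∀ z ∉ A, w z ≤ c) :
    ∫ z, Phi (w z) ∂(_root_.stdGaussian n) ≤ (_root_.stdGaussian n A).toReal + Phi c := by
  calc _ ≤ ∫ z, (A.indicator (fun _ => (1 : ℝ)) z + Phi c) ∂(_root_.stdGaussian n) := by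
        refine integral_mono (integrable_Phi_comp hw)
          (((integrable_const _).indicator hA).add (integrable_const _)) fun z => ?_
        by_cases hz : z ∈ A
        · simp only [Set.indicator_of_mem hz]
          linarith [(Phi_mem_Ioo (w z)).2, (Phi_mem_Ioo c).1]
        · simp only [Set.indicator_of_notMem hz, zero_add]
          exact strictMono_Phi.monotone (hc z hz)
    _ = _ := by
        rw [integral_add ((integrable_const _).indicator hA) (integrable_const _),
          integral_indicator_const _ hA]
        simp [Measure.real]

/-- The isoperimetric inequality for compact sets, with room to spare. -/
lemma Phi_le_measure_infDist_le {K : Set (EuclideanSpace ℝ (Fin n))} (hK : IsCompact K)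
    (hne : K.Nonempty) {a η ρ : ℝ} (ha : Phi a ≤ (_root_.stdGaussian n K).toReal) (hη : 0 < η)
    (hρ : 0 ≤ ρ) :
    Phi (a + ρ - 2 * η) ≤
      (_root_.stdGaussian n {x | Metric.infDist x K ≤ ρ + η}).toReal := by
  set A : Set (EuclideanSpace ℝ (Fin n)) := {x | Metric.infDist x K ≤ ρ + η} with hA_def
  have hA : MeasurableSet A :=
    (isClosed_le (Metric.continuous_infDist_pt K) continuous_const).measurableSet
  rcases lt_or_ge ρ η with hlt | hge
  · refine (strictMono_Phi.monotone (by linarith)).trans (ha.trans ?_)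
    refine ENNReal.toReal_mono (measure_ne_top _ _) (measure_mono fun x hx => ?_)
    rw [hA_def, Set.mem_ofPred_eq, Metric.infDist_zero_of_mem hx]
    positivity
  set R := ρ + η + 1 with hR
  have hR0 : 0 < R := by positivity
  obtain ⟨u, hu, hucs, hu1, huv⟩ := exists_contDiff_approx
    (v := fun x => max (R - Metric.infDist x K) 0)
    (by
      have h := (LipschitzWith.const (α := EuclideanSpace ℝ (Fin n)) R).sub
        (Metric.lipschitz_infDist_pt K)
      rw [zero_add] at h
      exact h.max_const 0)
    (by
      refine HasCompactSupport.intro' (K := Metric.cthickening R K) hK.cthickening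
        Metric.isClosed_cthickening fun x hx => ?_
      rw [hK.cthickening_eq_biUnion_closedBall hR0.le] at hx
      obtain ⟨y, hy, hxy⟩ := hK.exists_infDist_eq_dist hne x
      have : R < Metric.infDist x K := by
        by_contra! hcon
        exact hx (Set.mem_biUnion hy (by rwa [Metric.mem_closedBall, ← hxy]))
      exact max_eq_right (by linarith))
    (half_pos hη)
  obtain ⟨M, hM⟩ := hucs.exists_bound_of_continuous hu.continuous
  have hbound : ∀ᶠ L in atTop, Phi (PhiInv (Phi (L * (η / 2)) * Phi a) +
      (ρ - η) * (L / √(1 + L ^ 2))) ≤ (_root_.stdGaussian n A).toReal + Phi (-(L * (η / 2))) := by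
    filter_upwards [eventually_gt_atTop 0] with L hL
    set w : EuclideanSpace ℝ (Fin n) → ℝ := fun x => L * (u x + (η - R)) with hw_def
    have hw : ContDiff ℝ 1 w := contDiff_const.mul (hu.add contDiff_const)
    have hwd : fderiv ℝ w = fun x => L • fderiv ℝ u x := funext fun x => by
      rw [hw_def, fderiv_const_mul ((hu.differentiable one_ne_zero x).add_const _),
        fderiv_add_const]
    have hwM : ∀ z, |w z| ≤ L * (M + |η - R|) := fun z => by
      rw [hw_def, abs_mul, abs_of_pos hL]
      have := hM z
      rw [Real.norm_eq_abs] at this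
      exact mul_le_mul_of_nonneg_left ((abs_add_le _ _).trans (by linarith)) hL.le
    have hs : 0 ≤ L * (ρ - η) := mul_nonneg hL.le (by linarith)
    have key := PhiInv_integral_Phi_add_le hw hwM (L := L) (fun z => by
        rw [hwd, norm_smul, Real.norm_eq_abs, abs_of_pos hL]
        exact mul_le_of_le_one_right hL.le (hu1 z))
      (by rw [hwd]; exact (hucs.fderiv ℝ).smul_left (f := fun _ => L)) hs
    have h1 : Phi (L * (η / 2)) * Phi a ≤ ∫ z, Phi (w z) ∂(_root_.stdGaussian n) :=
      (mul_le_mul_of_nonneg_left ha (Phi_mem_Ioo _).1.le).trans <|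
        Phi_mul_measure_le_integral hw.continuous hK.measurableSet fun z hz => by
          have := (abs_le.1 (huv z)).1
          rw [Metric.infDist_zero_of_mem hz, sub_zero, max_eq_left hR0.le] at this
          exact mul_le_mul_of_nonneg_left (by linarith) hL.le
    have h2 := integral_Phi_le_measure_add (w := fun z => w z + L * (ρ - η))
      (hw.continuous.add continuous_const) hA (c := -(L * (η / 2))) fun z hz => by
        have h3 := (abs_le.1 (huv z)).2
        have h4 : ρ + η < Metric.infDist z K := not_le.1 hz
        have h5 : max (R - Metric.infDist z K) 0 ≤ 1 := max_le (by linarith) zero_le_one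
        rw [hw_def, ← mul_add, ← mul_neg]
        exact mul_le_mul_of_nonneg_left (by linarith) hL.le
    have hI := integral_Phi_mem_Ioo hw.continuous hwM
    have hJ := integral_Phi_mem_Ioo (w := fun z => w z + L * (ρ - η))
      (hw.continuous.add continuous_const) (M := L * (M + |η - R|) + |L * (ρ - η)|)
      fun z => (abs_add_le _ _).trans (by linarith [hwM z])
    have hmem : Phi (L * (η / 2)) * Phi a ∈ Set.Ioo (0 : ℝ) 1 :=
      ⟨mul_pos (Phi_mem_Ioo _).1 (Phi_mem_Ioo _).1, h1.trans_lt hI.2⟩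
    refine le_trans ?_ h2
    rw [← Phi_PhiInv hJ]
    refine strictMono_Phi.monotone (le_trans ?_ key)
    have := PhiInv_strictMonoOn.monotoneOn hmem hI h1
    have h6 : (ρ - η) * (L / √(1 + L ^ 2)) = L * (ρ - η) / √(1 + L ^ 2) := by ring
    linarith
  have hlim : Tendsto (fun L : ℝ => L * (η / 2)) atTop atTop :=
    tendsto_id.atTop_mul_const (half_pos hη)
  have hl : Tendsto (fun L : ℝ => Phi (PhiInv (Phi (L * (η / 2)) * Phi a) +
      (ρ - η) * (L / √(1 + L ^ 2)))) atTop (𝓝 (Phi (a + (ρ - η) * 1))) := by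
    refine (continuous_Phi.tendsto _).comp (Tendsto.add ?_
      (tendsto_div_sqrt_one_add_sq.const_mul _))
    have h := (tendsto_Phi_atTop.comp hlim).mul_const (Phi a)
    rw [one_mul] at h
    have := (hasDerivAt_PhiInv (Phi_mem_Ioo a)).continuousAt.tendsto.comp h
    rwa [PhiInv_Phi] at this
  have hr := (tendsto_Phi_atBot.comp (tendsto_neg_atTop_atBot.comp hlim)).const_add
    (_root_.stdGaussian n A).toReal
  rw [add_zero] at hr
  exact (strictMono_Phi.monotone (by linarith)).trans (le_of_tendsto_of_tendsto hl hr hbound)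

end Limit

theorem gaussian_isoperimetry_thickening
    (n : ℕ) (hn : 1 ≤ n) (U : Set (EuclideanSpace ℝ (Fin n)))
    (hU : MeasurableSet U) (r : ℝ) (hr : 0 ≤ r) (a : ℝ)
    (ha : Phi a ≤ (stdGaussian n U).toReal) :
    Phi (a + r) ≤ (stdGaussian n (thick U r)).toReal := by
  rcases hr.eq_or_lt with rfl | hr
  · rw [add_zero]
    exact ha.trans <| ENNReal.toReal_mono (measure_ne_top _ _) <| measure_mono fun x hx =>
      ⟨x, hx, by simp⟩
  have hlim : Tendsto (fun η => Phi ((a - η) + (r - η) - 2 * η)) (𝓝[>] 0) (𝓝 (Phi (a + r))) := by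
    have h : Continuous fun η => Phi ((a - η) + (r - η) - 2 * η) :=
      continuous_Phi.comp (by fun_prop)
    simpa using (h.tendsto 0).mono_left nhdsWithin_le_nhds
  refine le_of_tendsto hlim ?_
  filter_upwards [Ioo_mem_nhdsGT hr] with η hη
  have hlt : ENNReal.ofReal (Phi (a - η)) < _root_.stdGaussian n U := by
    rw [ENNReal.ofReal_lt_iff_lt_toReal (Phi_mem_Ioo _).1.le (measure_ne_top _ _)]
    exact (strictMono_Phi (by linarith [hη.1])).trans_le ha
  obtain ⟨K, hKU, hK, hlK⟩ := hU.exists_lt_isCompact hlt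
  have hne : K.Nonempty := by
    rw [Set.nonempty_iff_ne_empty]
    rintro rfl
    simp at hlK
  rw [ENNReal.ofReal_lt_iff_lt_toReal (Phi_mem_Ioo _).1.le (measure_ne_top _ _)] at hlK
  refine (Phi_le_measure_infDist_le hK hne hlK.le hη.1 (sub_nonneg.2 hη.2.le)).trans ?_
  refine ENNReal.toReal_mono (measure_ne_top _ _) (measure_mono fun x hx => ?_)
  obtain ⟨y, hy, hxy⟩ := hK.exists_infDist_eq_dist hne x
  rw [Set.mem_ofPred_eq, hxy, sub_add_cancel, dist_eq_norm] at hx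
  exact ⟨y, hKU hy, hx⟩
end

section
/- Let d ≥ 1, let c₀ > 0, and let φ : ℝᵈ → ℝᵈ be continuously differentiable with c₀‖x − y‖ ≤ ‖φ(x) − φ(y)‖ for all x, y ∈ ℝᵈ. Then the range of φ is an open subset of ℝᵈ. -/
/-- The derivative of a `c`-expansive map is bounded below by `c`. -/
theorem HasFDerivAt.mul_norm_le_of_expansive {E F : Type*}
    [NormedAddCommGroup E] [NormedSpace ℝ E] [NormedAddCommGroup F] [NormedSpace ℝ F]
    {f : E → F} {f' : E →L[ℝ] F} {x : E} {c : ℝ} (hf : HasFDerivAt f f' x)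
    (hexp : ∀ x y, c * ‖x - y‖ ≤ ‖f x - f y‖) (v : E) :
    c * ‖v‖ ≤ ‖f' v‖ := by
  refine ge_of_tendsto (hf.lim_real v).norm ?_
  filter_upwards [Filter.eventually_gt_atTop (0 : ℝ)] with t ht
  have h := hexp (x + t⁻¹ • v) x
  rw [add_sub_cancel_left, norm_smul, norm_inv, Real.norm_of_nonneg ht.le] at h
  rw [norm_smul, Real.norm_of_nonneg ht.le]
  calc c * ‖v‖ = t * (c * (t⁻¹ * ‖v‖)) := by field_simp
    _ ≤ t * ‖f (x + t⁻¹ • v) - f x‖ := by gcongr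

/-- A `C¹` expansive self-map of a finite-dimensional real normed space is open. -/
theorem ContDiff.isOpenMap_of_expansive {E : Type*} [NormedAddCommGroup E] [NormedSpace ℝ E]
    [FiniteDimensional ℝ E] {f : E → E} {c : ℝ} (hf : ContDiff ℝ 1 f) (hc : 0 < c)
    (hexp : ∀ x y, c * ‖x - y‖ ≤ ‖f x - f y‖) : IsOpenMap f := by
  have : CompleteSpace E := FiniteDimensional.complete ℝ E
  refine isOpenMap_iff_nhds_le.2 fun x => ?_
  have hx : HasStrictFDerivAt f (fderiv ℝ f x) x :=
    hf.contDiffAt.hasStrictFDerivAt one_ne_zero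
  refine (hx.map_nhds_eq_of_surj ?_).ge
  refine LinearMap.range_eq_top.2 (LinearMap.injective_iff_surjective.1 ?_)
  refine (injective_iff_map_eq_zero _).2 fun v hv => ?_
  have h := hx.hasFDerivAt.mul_norm_le_of_expansive hexp v
  rw [show fderiv ℝ f x v = 0 from hv, norm_zero] at h
  exact norm_le_zero_iff.1 (nonpos_of_mul_nonpos_right h hc)

theorem range_isOpen_of_expansive_contDiff
    (d : ℕ) (hd : 1 ≤ d) (c₀ : ℝ) (hc₀ : 0 < c₀)
    (φ : EuclideanSpace ℝ (Fin d) → EuclideanSpace ℝ (Fin d))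
    (hφ : ContDiff ℝ 1 φ)
    (hexp : ∀ x y, c₀ * ‖x - y‖ ≤ ‖φ x - φ y‖) :
    IsOpen (Set.range φ) := by
  exact (hφ.isOpenMap_of_expansive hc₀ hexp).isOpen_range
end

section
/- Let E be a real normed vector space, let T ≥ 1 and m ≥ 1 be integers, and let 0 ≤ L < 1. For each t ∈ {1, …, T}, let ψ_t = g_{t,m} ∘ ⋯ ∘ g_{t,1} be a composition of m maps g_{t,j} : E → E, each Lipschitz with constant L, and let B_t(x) = x + ψ_t(x). Then the composition φ = B_T ∘ B_{T−1} ∘ ⋯ ∘ B_1 satisfies (1 − L^m)^T ‖x − y‖ ≤ ‖φ(x) − φ(y)‖ for all x, y ∈ E. -/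
/-- Composition `f_T ∘ ⋯ ∘ f_1` of a finite tuple of maps (`f 0` is applied first). -/
def compTuple {E : Type*} {T : ℕ} (f : Fin T → E → E) : E → E :=
  (List.ofFn f).reverse.foldr (· ∘ ·) id

theorem compTuple_zero {E : Type*} (f : Fin 0 → E → E) : compTuple f = id := by
  simp [compTuple]

theorem compTuple_succ {E : Type*} {n : ℕ} (f : Fin (n + 1) → E → E) :
    compTuple f = f (Fin.last n) ∘ compTuple (fun i : Fin n => f i.castSucc) := by
  simp only [compTuple, List.ofFn_succ_last, List.reverse_append, List.reverse_singleton,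
    List.singleton_append, List.foldr_cons]

theorem norm_compTuple_sub_le {E : Type*} [SeminormedAddCommGroup E] {L : ℝ} (hL : 0 ≤ L)
    {n : ℕ} (f : Fin n → E → E) (hf : ∀ i x y, ‖f i x - f i y‖ ≤ L * ‖x - y‖) (x y : E) :
    ‖compTuple f x - compTuple f y‖ ≤ L ^ n * ‖x - y‖ := by
  induction n with
  | zero => simp [compTuple_zero]
  | succ n ih =>
    rw [compTuple_succ, pow_succ', mul_assoc]
    exact (hf _ _ _).trans
      (mul_le_mul_of_nonneg_left (ih (fun i => f i.castSucc) fun i => hf i.castSucc) hL)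

theorem le_norm_compTuple_sub {E : Type*} [SeminormedAddCommGroup E] {c : ℝ} (hc : 0 ≤ c)
    {n : ℕ} (f : Fin n → E → E) (hf : ∀ i x y, c * ‖x - y‖ ≤ ‖f i x - f i y‖) (x y : E) :
    c ^ n * ‖x - y‖ ≤ ‖compTuple f x - compTuple f y‖ := by
  induction n with
  | zero => simp [compTuple_zero]
  | succ n ih =>
    rw [compTuple_succ, pow_succ', mul_assoc]
    exact (mul_le_mul_of_nonneg_left (ih (fun i => f i.castSucc) fun i => hf i.castSucc) hc).trans
      (hf _ _ _)

/-- A perturbation of the identity by a `k`-Lipschitz map expands distances by at least `1 - k`. -/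
theorem one_sub_mul_norm_sub_le {E : Type*} [SeminormedAddCommGroup E] {k : ℝ} {p : E → E}
    {x y : E} (hp : ‖p x - p y‖ ≤ k * ‖x - y‖) :
    (1 - k) * ‖x - y‖ ≤ ‖(x + p x) - (y + p y)‖ := by
  have h := norm_sub_le_norm_add (x - y) (p x - p y)
  rw [add_sub_add_comm]
  linarith

theorem residual_network_expansive
    {E : Type*} [NormedAddCommGroup E] [NormedSpace ℝ E]
    (T m : ℕ) (hT : 1 ≤ T) (hm : 1 ≤ m) (L : ℝ) (hL0 : 0 ≤ L) (hL1 : L < 1)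
    (g : Fin T → Fin m → E → E)
    (hg : ∀ t j, ∀ x y, ‖g t j x - g t j y‖ ≤ L * ‖x - y‖)
    (ψ : Fin T → E → E) (hψ : ∀ t, ψ t = compTuple (g t))
    (B : Fin T → E → E) (hB : ∀ t x, B t x = x + ψ t x)
    (φ : E → E) (hφ : φ = compTuple B) (x y : E) :
    (1 - L ^ m) ^ T * ‖x - y‖ ≤ ‖φ x - φ y‖ := by
  subst hφ
  refine le_norm_compTuple_sub (sub_nonneg.2 (pow_le_one₀ hL0 hL1.le)) B (fun t u v => ?_) x y
  rw [hB, hB]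
  refine one_sub_mul_norm_sub_le ?_
  rw [hψ]
  exact norm_compTuple_sub_le hL0 (g t) (hg t) u v
end

section
/- For every x ∈ ℝ and every a ≥ 0, min{ Φ(x + a) − Φ(x), Φ(x), Φ(x) − Φ(x − a) } = Φ(−|x|) − Φ(−|x| − a). -/
/-- The standard normal density, as it appears in the definition of `Phi`. -/
noncomputable def stdNormalDensity (t : ℝ) : ℝ :=
  (2 * Real.pi) ^ (-(1 : ℝ) / 2) * Real.exp (-t ^ 2 / 2)

theorem stdNormalDensity_nonneg (t : ℝ) : 0 ≤ stdNormalDensity t := by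
  unfold stdNormalDensity
  positivity

theorem stdNormalDensity_neg (t : ℝ) : stdNormalDensity (-t) = stdNormalDensity t := by
  simp [stdNormalDensity]

theorem stdNormalDensity_le_of_sq_le {s t : ℝ} (h : s ^ 2 ≤ t ^ 2) :
    stdNormalDensity t ≤ stdNormalDensity s := by
  unfold stdNormalDensity
  gcongr

theorem continuous_stdNormalDensity : Continuous stdNormalDensity := by
  unfold stdNormalDensity
  fun_prop

theorem integrable_stdNormalDensity : MeasureTheory.Integrable stdNormalDensity := by
  have h := (integrable_exp_neg_mul_sq (b := 1 / 2) (by norm_num)).const_mul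
    ((2 * Real.pi) ^ (-(1 : ℝ) / 2))
  convert h using 2 with t
  unfold stdNormalDensity
  ring_nf

theorem Phi_nonneg (x : ℝ) : 0 ≤ Phi x :=
  MeasureTheory.integral_nonneg stdNormalDensity_nonneg

theorem Phi_sub_Phi (a b : ℝ) : Phi b - Phi a = ∫ t in a..b, stdNormalDensity t :=
  intervalIntegral.integral_Iic_sub_Iic integrable_stdNormalDensity.integrableOn
    integrable_stdNormalDensity.integrableOn

theorem Phi_neg_sub_Phi_neg (a b : ℝ) : Phi (-a) - Phi (-b) = Phi b - Phi a := by
  rw [Phi_sub_Phi, Phi_sub_Phi, ← intervalIntegral.integral_comp_neg]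
  simp only [stdNormalDensity_neg]

theorem Phi_add_sub_le_sub_sub {x a : ℝ} (hx : 0 ≤ x) (ha : 0 ≤ a) :
    Phi (x + a) - Phi x ≤ Phi x - Phi (x - a) := by
  have right : Phi (x + a) - Phi x = ∫ s in (0 : ℝ)..a, stdNormalDensity (x + s) := by
    rw [intervalIntegral.integral_comp_add_left, Phi_sub_Phi, add_zero]
  have left : Phi x - Phi (x - a) = ∫ s in (0 : ℝ)..a, stdNormalDensity (x - s) := by
    rw [intervalIntegral.integral_comp_sub_left, Phi_sub_Phi, sub_zero]
  rw [right, left]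
  have hc := continuous_stdNormalDensity
  refine intervalIntegral.integral_mono_on ha
    ((hc.comp (by fun_prop)).intervalIntegrable _ _)
    ((hc.comp (by fun_prop)).intervalIntegrable _ _) fun s hs => ?_
  exact stdNormalDensity_le_of_sq_le (by nlinarith [mul_nonneg hx hs.1])

theorem min_of_gaussian_interval_probs (x : ℝ) (a : ℝ) (ha : 0 ≤ a) :
    min (Phi (x + a) - Phi x) (min (Phi x) (Phi x - Phi (x - a)))
      = Phi (-|x|) - Phi (-|x| - a) := by
  rcases le_total 0 x with hx | hx
  · have key := Phi_add_sub_le_sub_sub hx ha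
    have symm := Phi_neg_sub_Phi_neg x (x + a)
    rw [abs_of_nonneg hx, ← neg_add', symm]
    exact min_eq_left (le_min (by linarith [Phi_nonneg (x - a)]) key)
  · have key := Phi_add_sub_le_sub_sub (neg_nonneg.mpr hx) ha
    rw [show -x + a = -(x - a) by ring, ← neg_add', Phi_neg_sub_Phi_neg,
      Phi_neg_sub_Phi_neg] at key
    rw [abs_of_nonpos hx, neg_neg,
      min_eq_right (a := Phi x) (by linarith [Phi_nonneg (x - a)])]
    exact min_eq_right key
end
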